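/- Let 0 < ε < 1 be real. Then for every integer g > 1/ε there exist a B₂[g] sequence A ⊆ ℕ and a threshold N₀ ∈ ℕ such that every integer n ≥ N₀ can be written as n = a₁ + a₂ + a₃ with a₁, a₂, a₃ ∈ A and a₃ ≤ n^{ε}. -/

import Mathlib

noncomputable section

/-- Number of representations of `m` as `b₁ + b₂` with `b₁ ≤ b₂`, `b₁, b₂ ∈ A`. -/
def rA (A : Set ℕ) (m : ℕ) : ℕ :=
  Set.ncard {p : ℕ × ℕ | p.1 ∈ A ∧ p.2 ∈ A ∧ p.1 ≤ p.2 ∧ p.1 + p.2 = m}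

/-- `A` is a `B₂[g]` sequence. -/
def IsB2g (A : Set ℕ) (g : ℕ) : Prop := ∀ m : ℕ, rA A m ≤ g

section

open Finset Real

/-- The `x ≤ m / 2` for which `m = x + (m - x)` is a representation of `m` in `C`. -/
def reps (C : Finset ℕ) (m : ℕ) : Finset ℕ :=
  (range (m + 1)).filter fun x => 2 * x ≤ m ∧ x ∈ C ∧ m - x ∈ C

/-- Expectation of `f S` for a random subset `S` of `J` whose elements are chosen independently,
each with odds `t`. -/
def avg (J : Finset ℕ) (t : ℝ) (f : Finset ℕ → ℝ) : ℝ :=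
  (∑ S ∈ J.powerset, t ^ S.card * f S) / (1 + t) ^ J.card

section Avg

variable {J : Finset ℕ} {t : ℝ}

lemma sum_powerset_pow_card (J : Finset ℕ) (t : ℝ) :
    ∑ S ∈ J.powerset, t ^ S.card = (1 + t) ^ J.card := by
  have := Finset.sum_pow_mul_eq_add_pow t 1 J
  simpa [add_comm] using this

lemma avg_const (ht : 0 < t) (c : ℝ) : avg J t (fun _ => c) = c := by
  unfold avg
  rw [← Finset.sum_mul, sum_powerset_pow_card]
  field_simp

lemma avg_add (f h : Finset ℕ → ℝ) :
    avg J t (fun S => f S + h S) = avg J t f + avg J t h := by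
  simp only [avg, mul_add, Finset.sum_add_distrib, add_div]

lemma avg_const_mul (c : ℝ) (f : Finset ℕ → ℝ) :
    avg J t (fun S => c * f S) = c * avg J t f := by
  simp only [avg, ← mul_div_assoc, Finset.mul_sum]
  congr 1
  exact Finset.sum_congr rfl fun _ _ => by ring

lemma avg_sum {ι : Type*} (s : Finset ι) (f : ι → Finset ℕ → ℝ) :
    avg J t (fun S => ∑ i ∈ s, f i S) = ∑ i ∈ s, avg J t (f i) := by
  simp only [avg, ← Finset.sum_div, Finset.mul_sum]
  rw [Finset.sum_comm]

lemma avg_mono (ht : 0 < t) {f h : Finset ℕ → ℝ} (hfh : ∀ S ⊆ J, f S ≤ h S) :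
    avg J t f ≤ avg J t h := by
  unfold avg
  gcongr with S hS
  exact hfh S (Finset.mem_powerset.mp hS)

lemma exists_lt_of_avg_lt (ht : 0 < t) {f : Finset ℕ → ℝ} {c : ℝ} (h : avg J t f < c) :
    ∃ S ⊆ J, f S < c := by
  by_contra! hcon
  have := avg_mono (J := J) ht hcon
  rw [avg_const ht] at this
  linarith

lemma sum_superset (D : Finset ℕ) (hD : D ⊆ J) (H : Finset ℕ → ℝ) :
    ∑ S ∈ J.powerset, t ^ S.card * (if D ⊆ S then H (S \ D) else 0) =
      t ^ D.card * ∑ S ∈ (J \ D).powerset, t ^ S.card * H S := by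
  simp only [mul_ite, mul_zero]
  rw [← Finset.sum_filter, Finset.mul_sum]
  refine Finset.sum_bij' (fun S _ => S \ D) (fun S _ => S ∪ D) ?_ ?_ ?_ ?_ ?_
  · intro S hS
    simp only [Finset.mem_filter, Finset.mem_powerset] at hS ⊢
    exact Finset.sdiff_subset_sdiff hS.1 le_rfl
  · intro S hS
    simp only [Finset.mem_filter, Finset.mem_powerset] at hS ⊢
    exact ⟨Finset.union_subset (hS.trans Finset.sdiff_subset) hD, Finset.subset_union_right⟩
  · intro S hS
    simp only [Finset.mem_filter] at hS
    exact Finset.sdiff_union_of_subset hS.2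
  · intro S hS
    simp only [Finset.mem_powerset] at hS
    rw [Finset.union_sdiff_right]
    exact Finset.sdiff_eq_self_of_disjoint (Finset.disjoint_of_subset_left hS Finset.sdiff_disjoint)
  · intro S hS
    simp only [Finset.mem_filter] at hS
    rw [← mul_assoc, ← pow_add, Finset.card_sdiff_of_subset hS.2,
      Nat.add_sub_cancel' (Finset.card_le_card hS.2)]

/-- Planting `D` in the random set costs at most a factor `t ^ |D|`. -/
lemma avg_superset_le (ht : 0 < t) {D : Finset ℕ} (hD : D ⊆ J) {H : Finset ℕ → ℝ}
    (hH : ∀ S, 0 ≤ H S) :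
    avg J t (fun S => if D ⊆ S then H (S \ D) else 0) ≤ t ^ D.card * avg J t H := by
  unfold avg
  rw [sum_superset D hD, mul_div_assoc]
  gcongr
  · intros
    exact mul_nonneg (by positivity) (hH _)
  · exact Finset.powerset_mono.mpr Finset.sdiff_subset

lemma avg_superset (ht : 0 < t) {D : Finset ℕ} (hD : D ⊆ J) :
    avg J t (fun S => if D ⊆ S then 1 else 0) = (t / (1 + t)) ^ D.card := by
  unfold avg
  have := sum_superset (t := t) D hD (fun _ => 1)
  rw [this]
  simp only [mul_one]
  rw [sum_powerset_pow_card, Finset.card_sdiff_of_subset hD, div_pow]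
  have h := Finset.card_le_card hD
  rw [div_eq_div_iff (by positivity) (by positivity), mul_assoc, ← pow_add, Nat.sub_add_cancel h]

lemma avg_superset_le_pow (ht : 0 < t) {D : Finset ℕ} (hD : D ⊆ J) :
    avg J t (fun S => if D ⊆ S then 1 else 0) ≤ t ^ D.card := by
  rw [avg_superset ht hD]
  gcongr
  exact div_le_self ht.le (by linarith)

end Avg

/-- The part of the pair `x, m - x` that is not already in `A`. -/
def missing (A : Finset ℕ) (m x : ℕ) : Finset ℕ := {x, m - x} \ A

/-- The pairs in `J` with sum `m` that are not pairs of `A`. -/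
def newPairs (A J : Finset ℕ) (m : ℕ) : Finset ℕ :=
  (range (m + 1)).filter fun x => 2 * x ≤ m ∧ x ∈ J ∧ m - x ∈ J ∧ ¬ (x ∈ A ∧ m - x ∈ A)

section Potential

variable {A J : Finset ℕ} {t z : ℝ} {m : ℕ}

lemma missing_subset {x : ℕ} (h : x ∈ newPairs A J m) : missing A m x ⊆ J := by
  simp only [newPairs, Finset.mem_filter] at h
  intro y hy
  simp only [missing, Finset.mem_sdiff, Finset.mem_insert, Finset.mem_singleton] at hy
  rcases hy.1 with rfl | rfl
  · exact h.2.2.1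
  · exact h.2.2.2.1

lemma missing_disjoint {x y : ℕ} (hx : x ∈ newPairs A J m) (hy : y ∈ newPairs A J m)
    (hxy : x ≠ y) : Disjoint (missing A m x) (missing A m y) := by
  simp only [newPairs, Finset.mem_filter, Finset.mem_range] at hx hy
  rw [Finset.disjoint_left]
  intro a ha hb
  simp only [missing, Finset.mem_sdiff, Finset.mem_insert, Finset.mem_singleton] at ha hb
  omega

lemma reps_union {S : Finset ℕ} (hA : A ⊆ J) (hS : S ⊆ J) :
    (reps (A ∪ S) m).card =
      (reps A m).card + ((newPairs A J m).filter fun x => missing A m x ⊆ S).card := by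
  rw [← Finset.card_union_of_disjoint]
  · congr 1
    ext x
    have h1 := @hA x
    have h2 := @hA (m - x)
    have h3 := @hS x
    have h4 := @hS (m - x)
    simp only [reps, newPairs, missing, Finset.mem_filter, Finset.mem_union, Finset.mem_range,
      Finset.subset_iff, Finset.mem_sdiff, Finset.mem_insert, Finset.mem_singleton, and_imp,
      forall_eq_or_imp, forall_eq]
    tauto
  · rw [Finset.disjoint_left]
    intro x hx hy
    simp only [reps, newPairs, Finset.mem_filter] at hx hy
    tauto

/-- The expected number of new representations is at most this sum. -/
lemma sum_missing_le (ht : 0 < t) (ht1 : t ≤ 1) :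
    ∑ x ∈ newPairs A J m, t ^ (missing A m x).card ≤ J.card * t ^ 2 + (2 * A.card + 1) * t := by
  have key : ∀ x ∈ newPairs A J m, t ^ (missing A m x).card ≤
      t ^ 2 + (if x ∈ A then t else 0) + (if m - x ∈ A then t else 0) +
        (if x = m / 2 then t else 0) := by
    intro x hx
    have n1 : (0:ℝ) ≤ if x ∈ A then t else 0 := by split_ifs <;> linarith
    have n2 : (0:ℝ) ≤ if m - x ∈ A then t else 0 := by split_ifs <;> linarith
    have n3 : (0:ℝ) ≤ if x = m / 2 then t else 0 := by split_ifs <;> linarith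
    simp only [newPairs, Finset.mem_filter, Finset.mem_range] at hx
    have n4 : 0 ≤ t ^ 2 := by positivity
    have hne : (missing A m x).Nonempty := by
      by_cases hxA : x ∈ A
      · exact ⟨m - x, by simp [missing]; tauto⟩
      · exact ⟨x, by simp [missing]; tauto⟩
    have hle : t ^ (missing A m x).card ≤ t := by
      calc t ^ (missing A m x).card ≤ t ^ 1 :=
            pow_le_pow_of_le_one ht.le ht1 (Finset.card_pos.mpr hne)
        _ = t := pow_one t
    by_cases h1 : x ∈ A
    · rw [if_pos h1] at n1 ⊢; linarith
    by_cases h2 : m - x ∈ A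
    · rw [if_pos h2] at n2 ⊢; linarith
    by_cases h3 : x = m / 2
    · rw [if_pos h3] at n3 ⊢; linarith
    · have : (missing A m x).card = 2 := by
        by_cases h4 : x = m - x
        · have h5 : missing A m x ⊆ {x} := by
            intro y
            simp only [missing, ← h4]
            simp
            tauto
          omega
        · have : missing A m x = {x, m - x} := by
            rw [missing, Finset.sdiff_eq_self_iff_disjoint, Finset.disjoint_left]
            simp [h1, h2]
          rw [this, Finset.card_pair h4]
      rw [this]; linarith
  have hsub : newPairs A J m ⊆ J := fun x hx => by
    simp only [newPairs, Finset.mem_filter] at hx; exact hx.2.2.1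
  have hU : ((newPairs A J m).card : ℝ) ≤ J.card := by exact_mod_cast Finset.card_le_card hsub
  have c1 : (((newPairs A J m).filter fun x => x ∈ A).card : ℝ) ≤ A.card := by
    exact_mod_cast Finset.card_le_card fun x hx => (Finset.mem_filter.mp hx).2
  have c2 : (((newPairs A J m).filter fun x => m - x ∈ A).card : ℝ) ≤ A.card := by
    norm_cast
    refine Finset.card_le_card_of_injOn (fun x => m - x)
      (fun x hx => (Finset.mem_filter.mp hx).2) ?_
    intro x hx y hy hxy
    have h1 := (Finset.mem_filter.mp (Finset.mem_filter.mp hx).1).2.1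
    have h2 := (Finset.mem_filter.mp (Finset.mem_filter.mp hy).1).2.1
    simp only at hxy
    omega
  have c3 : (((newPairs A J m).filter fun x => x = m / 2).card : ℝ) ≤ 1 := by
    norm_cast
    refine (Finset.card_le_card (t := {m / 2}) ?_).trans (by simp)
    intro x hx
    simpa using (Finset.mem_filter.mp hx).2
  refine (Finset.sum_le_sum key).trans ?_
  simp only [Finset.sum_add_distrib, Finset.sum_const, ← Finset.sum_filter, nsmul_eq_mul]
  nlinarith [mul_le_mul_of_nonneg_right hU (sq_nonneg t), mul_le_mul_of_nonneg_right c1 ht.le,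
    mul_le_mul_of_nonneg_right c2 ht.le, mul_le_mul_of_nonneg_right c3 ht.le]

lemma avg_pow_reps_le (hA : A ⊆ J) (ht : 0 < t) (hz : 1 ≤ z) :
    avg J t (fun S => z ^ (reps (A ∪ S) m).card) ≤
      z ^ (reps A m).card * Real.exp (z * ∑ x ∈ newPairs A J m, t ^ (missing A m x).card) := by
  set U := newPairs A J m with hU
  have hexp : ∀ S ⊆ J, z ^ (reps (A ∪ S) m).card ≤ z ^ (reps A m).card *
      ∑ T ∈ U.powerset, (z - 1) ^ T.card * (if T.biUnion (missing A m) ⊆ S then 1 else 0) := by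
    intro S hS
    rw [reps_union hA hS, pow_add, ← hU]
    refine le_of_eq ?_
    congr 1
    have := sum_powerset_pow_card (U.filter fun x => missing A m x ⊆ S) (z - 1)
    rw [add_sub_cancel] at this
    rw [← this]
    simp only [mul_ite, mul_one, mul_zero]
    rw [← Finset.sum_filter]
    refine Finset.sum_congr ?_ fun _ _ => rfl
    ext T
    simp only [Finset.mem_powerset, Finset.mem_filter, Finset.biUnion_subset, Finset.subset_iff (s₁ := T)]
    exact forall₂_and
  refine (avg_mono ht hexp).trans ?_
  rw [avg_const_mul]
  have hz0 : 0 ≤ z - 1 := by linarith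
  gcongr
  rw [avg_sum]
  have hT : ∀ T ∈ U.powerset, avg J t (fun S => (z - 1) ^ T.card *
      (if T.biUnion (missing A m) ⊆ S then 1 else 0)) ≤
      ∏ x ∈ T, (z * t ^ (missing A m x).card) := by
    intro T hT
    rw [Finset.mem_powerset] at hT
    rw [avg_const_mul, Finset.prod_mul_distrib, Finset.prod_const]
    have hsub : T.biUnion (missing A m) ⊆ J :=
      Finset.biUnion_subset.mpr fun x hx => missing_subset (hT hx)
    have hcard : (T.biUnion (missing A m)).card = ∑ x ∈ T, (missing A m x).card :=
      Finset.card_biUnion fun x hx y hy hxy => missing_disjoint (hT hx) (hT hy) hxy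
    have := avg_superset_le_pow ht hsub
    rw [hcard, ← Finset.prod_pow_eq_pow_sum] at this
    have hp : 0 ≤ ∏ x ∈ T, t ^ (missing A m x).card :=
      Finset.prod_nonneg fun _ _ => by positivity
    calc _ ≤ (z - 1) ^ T.card * ∏ x ∈ T, t ^ (missing A m x).card := by gcongr
      _ ≤ _ := by gcongr; linarith
  refine (Finset.sum_le_sum hT).trans ?_
  rw [← Finset.prod_one_add, Finset.mul_sum, Real.exp_sum]
  refine Finset.prod_le_prod (fun _ _ => by positivity) fun x _ => ?_
  rw [add_comm]
  exact Real.add_one_le_exp _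

end Potential

/-- `∑ z ^ r(m)` over `m ≤ 24 N`. -/
def potential (N : ℕ) (z : ℝ) (A : Finset ℕ) : ℝ :=
  ∑ m ∈ range (24 * N + 1), z ^ (reps A m).card

/-- The `m ≤ 24 N` with at least `g` representations in `C`. -/
def rich (N g : ℕ) (C : Finset ℕ) : Finset ℕ :=
  (range (24 * N + 1)).filter fun m => g ≤ (reps C m).card

lemma reps_mono {A C : Finset ℕ} (h : A ⊆ C) (m : ℕ) : reps A m ⊆ reps C m := by
  intro x hx
  simp only [reps, Finset.mem_filter] at hx ⊢
  exact ⟨hx.1, hx.2.1, h hx.2.2.1, h hx.2.2.2⟩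

lemma potential_mono {N : ℕ} {z : ℝ} (hz : 1 ≤ z) {A C : Finset ℕ} (h : A ⊆ C) :
    potential N z A ≤ potential N z C := by
  unfold potential
  gcongr with m hm
  exact reps_mono h m

lemma mul_card_sq_le_potential {N : ℕ} {z : ℝ} (hz : 2 ≤ z) {A : Finset ℕ}
    (hA : A ⊆ range (12 * N + 1)) : z * (A.card : ℝ) ^ 2 ≤ 2 * potential N z A := by
  have h1 : A.card ^ 2 ≤ 2 * ∑ m ∈ range (24 * N + 1), (reps A m).card := by
    set Q := (A ×ˢ A).filter fun q => q.1 ≤ q.2 with hQ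
    have h2 : A ×ˢ A ⊆ Q ∪ Q.image Prod.swap := by
      rintro ⟨a, b⟩ hab
      simp only [Finset.mem_product] at hab
      simp only [hQ, Finset.mem_union, Finset.mem_filter, Finset.mem_product, Finset.mem_image,
        Prod.exists, Prod.swap_prod_mk, Prod.mk.injEq]
      rcases le_total a b with h | h
      · exact Or.inl ⟨hab, h⟩
      · exact Or.inr ⟨b, a, ⟨⟨hab.2, hab.1⟩, h⟩, rfl, rfl⟩
    have h3 : Q.card ≤ ∑ m ∈ range (24 * N + 1), (reps A m).card := by
      rw [Finset.card_eq_sum_card_fiberwise (f := fun q => q.1 + q.2) (t := range (24 * N + 1))]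
      · refine Finset.sum_le_sum fun m _ => Finset.card_le_card_of_injOn Prod.fst ?_ ?_
        · rintro ⟨a, b⟩ h
          simp only [hQ, Finset.coe_filter, Finset.mem_filter, Finset.mem_product,
            Set.mem_ofPred_eq] at h
          obtain ⟨⟨⟨ha, hb⟩, hab⟩, rfl⟩ := h
          simp only [reps, Finset.coe_filter, Finset.mem_range, Set.mem_ofPred_eq]
          refine ⟨by omega, by omega, ha, ?_⟩
          rwa [Nat.add_sub_cancel_left]
        · rintro ⟨a, b⟩ h ⟨a', b'⟩ h' heq
          simp only [Finset.coe_filter, Set.mem_ofPred_eq] at h h' heq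
          simp only [Prod.mk.injEq]
          omega
      · rintro ⟨a, b⟩ h
        simp only [hQ, Finset.coe_filter, Finset.mem_product, Set.mem_ofPred_eq] at h
        have ha := Finset.mem_range.mp (hA h.1.1)
        have hb := Finset.mem_range.mp (hA h.1.2)
        simp only [Finset.coe_range, Set.mem_Iio]
        omega
    have h4 := Finset.card_le_card h2
    rw [Finset.card_product] at h4
    have h5 := Finset.card_union_le Q (Q.image Prod.swap)
    have h6 := Finset.card_image_le (s := Q) (f := Prod.swap)
    rw [sq]
    omega
  have h2 : ∀ r : ℕ, z * r ≤ z ^ r := by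
    intro r
    rcases r with _ | r
    · simp
    · rw [pow_succ']
      gcongr
      have : r + 1 ≤ 2 ^ r := Nat.lt_two_pow_self
      calc ((r + 1 : ℕ) : ℝ) ≤ (2 : ℝ) ^ r := by exact_mod_cast this
        _ ≤ z ^ r := by gcongr
  have h3 : (A.card : ℝ) ^ 2 ≤ 2 * ∑ m ∈ range (24 * N + 1), ((reps A m).card : ℝ) := by
    exact_mod_cast h1
  calc z * (A.card : ℝ) ^ 2 ≤ z * (2 * ∑ m ∈ range (24 * N + 1), ((reps A m).card : ℝ)) := by
        gcongr
    _ = 2 * ∑ m ∈ range (24 * N + 1), z * ((reps A m).card : ℝ) := by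
        rw [← Finset.mul_sum]; ring
    _ ≤ _ := by
        unfold potential
        gcongr
        exact h2 _

lemma card_rich_mul_le_potential {N g : ℕ} {z : ℝ} (hz : 1 ≤ z) (A : Finset ℕ) :
    ((rich N g A).card : ℝ) * z ^ g ≤ potential N z A := by
  rw [← nsmul_eq_mul, ← Finset.sum_const]
  refine (Finset.sum_le_sum (g := fun m => z ^ (reps A m).card) fun m hm => ?_).trans
    (Finset.sum_le_sum_of_subset_of_nonneg (Finset.filter_subset _ _) fun _ _ _ => by positivity)
  exact pow_le_pow_right₀ hz (Finset.mem_filter.mp hm).2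

/-- Some representation-rich sum of `C` uses `a`. -/
def IsBad (C : Finset ℕ) (g a : ℕ) : Prop := ∃ y ∈ C, g < (reps C (a + y)).card

/-- The `a` that may become bad once `a` and `s - a` are added to `C`, for a reason other than
`s` having a representation in `C`. -/
def suspects (N g : ℕ) (C : Finset ℕ) (s : ℕ) : Finset ℕ :=
  (range (12 * N + 1)).filter fun a => (reps C (2 * a)).Nonempty ∨
    (∃ y ∈ C, g ≤ (reps C (a + y)).card) ∨ (∃ y ∈ C, ∃ x ∈ C, 2 * a + y = s + x) ∨
    ∃ y ∈ C, 3 * a + y = 2 * s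

lemma IsBad.pair {C : Finset ℕ} {N g a b : ℕ} (hg : 2 ≤ g) (ha : a ∈ range (12 * N + 1))
    (h : IsBad (C ∪ {a, b}) g a) :
    (reps C (a + b)).Nonempty ∨ a ∈ suspects N g C (a + b) := by
  obtain ⟨y, hy, hcard⟩ := h
  set R := reps (C ∪ {a, b}) (a + y) with hR
  have hsub : R ⊆ reps C (a + y) ∪ ({min a y} ∪ R.filter fun x => x = b ∨ a + y - x = b) := by
    intro x hx
    have hx' := hx
    simp only [hR, reps, Finset.mem_filter, Finset.mem_range, Finset.mem_union, Finset.mem_insert,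
      Finset.mem_singleton] at hx
    simp only [Finset.mem_union, Finset.mem_singleton, Finset.mem_filter, hx', true_and]
    simp only [reps, Finset.mem_filter, Finset.mem_range]
    by_cases h1 : x = b
    · tauto
    by_cases h2 : a + y - x = b
    · tauto
    by_cases h3 : x = min a y
    · tauto
    have h4 : x ≠ a := by omega
    have h5 : a + y - x ≠ a := by omega
    left
    tauto
  have hone : (R.filter fun x => x = b ∨ a + y - x = b).card ≤ 1 := by
    rw [Finset.card_le_one]
    intro x hx x' hx'
    simp only [hR, reps, Finset.mem_filter, Finset.mem_range] at hx hx'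
    omega
  have hc := Finset.card_le_card hsub
  have hu := Finset.card_union_le (reps C (a + y))
    ({min a y} ∪ R.filter fun x => x = b ∨ a + y - x = b)
  have hu' := Finset.card_union_le {min a y} (R.filter fun x => x = b ∨ a + y - x = b)
  rw [Finset.card_singleton] at hu'
  have hpos : 0 < (reps C (a + y)).card := by omega
  by_cases hyb : y = b
  · subst hyb
    exact Or.inl (Finset.card_pos.mp hpos)
  right
  simp only [suspects, Finset.mem_filter, ha, true_and]
  by_cases hya : y = a
  · subst hya
    left
    rw [two_mul]
    exact Finset.card_pos.mp hpos
  have hyC : y ∈ C := by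
    simp only [Finset.mem_union, Finset.mem_insert, Finset.mem_singleton] at hy
    tauto
  rcases Finset.eq_empty_or_nonempty (R.filter fun x => x = b ∨ a + y - x = b) with he | ⟨x, hx⟩
  · rw [he] at hc hu hu'
    rw [Finset.card_empty] at hu'
    exact Or.inr (Or.inl ⟨y, hyC, by omega⟩)
  · have hz : ∃ z ∈ C ∪ {a, b}, a + y = b + z := by
      simp only [hR, reps, Finset.mem_filter, Finset.mem_range] at hx
      rcases hx.2 with rfl | h
      · exact ⟨a + y - x, hx.1.2.2.2, by omega⟩
      · exact ⟨x, hx.1.2.2.1, by omega⟩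
    obtain ⟨z, hz, hab⟩ := hz
    by_cases hzb : z = b
    · exact Or.inr (Or.inr (Or.inr ⟨y, hyC, by omega⟩))
    · have hzC : z ∈ C := by
        simp only [Finset.mem_union, Finset.mem_insert, Finset.mem_singleton] at hz
        rcases hz with h | h | h
        · exact h
        · omega
        · exact absurd h hzb
      exact Or.inr (Or.inr (Or.inl ⟨y, hyC, z, hzC, by omega⟩))

lemma card_suspects_le {N g s : ℕ} {C : Finset ℕ} (hC : C ⊆ range (12 * N + 1)) :
    (suspects N g C s).card ≤ 3 * C.card ^ 2 + C.card * (rich N g C).card := by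
  have hsub : suspects N g C s ⊆
      (C ×ˢ C).image (fun q => (q.1 + q.2) / 2) ∪ (C ×ˢ rich N g C).image (fun q => q.2 - q.1) ∪
      (C ×ˢ C).image (fun q => (s + q.2 - q.1) / 2) ∪ C.image (fun y => (2 * s - y) / 3) := by
    intro a ha
    simp only [suspects, Finset.mem_filter] at ha
    simp only [Finset.mem_union, Finset.mem_image, Finset.mem_product, Prod.exists]
    obtain ⟨haN, h | ⟨y, hy, h⟩ | ⟨y, hy, x, hx, h⟩ | ⟨y, hy, h⟩⟩ := ha
    · obtain ⟨x, hx⟩ := h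
      simp only [reps, Finset.mem_filter] at hx
      exact Or.inl (Or.inl (Or.inl ⟨x, _, hx.2.2, by omega⟩))
    · refine Or.inl (Or.inl (Or.inr ⟨y, a + y, ⟨hy, ?_⟩, by omega⟩))
      have := Finset.mem_range.mp (hC hy)
      have := Finset.mem_range.mp haN
      simp only [rich, Finset.mem_filter, Finset.mem_range]
      exact ⟨by omega, h⟩
    · exact Or.inl (Or.inr ⟨y, x, ⟨hy, hx⟩, by omega⟩)
    · exact Or.inr ⟨y, hy, by omega⟩
  refine (Finset.card_le_card hsub).trans ?_
  refine (Finset.card_union_le _ _).trans ?_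
  have h1 := Finset.card_union_le ((C ×ˢ C).image (fun q => (q.1 + q.2) / 2) ∪
    (C ×ˢ rich N g C).image (fun q => q.2 - q.1)) ((C ×ˢ C).image (fun q => (s + q.2 - q.1) / 2))
  have h2 := Finset.card_union_le ((C ×ˢ C).image (fun q => (q.1 + q.2) / 2))
    ((C ×ˢ rich N g C).image (fun q => q.2 - q.1))
  have h3 := Finset.card_image_le (s := C ×ˢ C) (f := fun q => (q.1 + q.2) / 2)
  have h4 := Finset.card_image_le (s := C ×ˢ rich N g C) (f := fun q => q.2 - q.1)
  have h5 := Finset.card_image_le (s := C ×ˢ C) (f := fun q => (s + q.2 - q.1) / 2)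
  have h6 := Finset.card_image_le (s := C) (f := fun y => (2 * s - y) / 3)
  rw [Finset.card_product] at h3 h4 h5
  have h7 : C.card ≤ C.card ^ 2 := Nat.le_self_pow (by norm_num) _
  rw [← sq] at h3 h5
  omega

section SecondMoment

variable {N n : ℕ} {t : ℝ} {W : Finset ℕ}

/-- The pair of summands attached to the index `i = (a, w)` in `n = a + (n - w - a) + w`. -/
def summands (n : ℕ) (i : ℕ × ℕ) : Finset ℕ := {i.1, n - i.2 - i.1}

lemma summands_subset (hn : n < 12 * N) {i : ℕ × ℕ} (hi : i ∈ Ioc N (2 * N) ×ˢ W) :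
    summands n i ⊆ range (12 * N + 1) := by
  simp only [Finset.mem_product, Finset.mem_Ioc] at hi
  intro x hx
  simp only [summands, Finset.mem_insert, Finset.mem_singleton] at hx
  simp only [Finset.mem_range]
  omega

lemma card_summands (hn : 6 * N ≤ n) (hW : W ⊆ range (N + 1)) {i : ℕ × ℕ}
    (hi : i ∈ Ioc N (2 * N) ×ˢ W) : (summands n i).card = 2 := by
  simp only [Finset.mem_product, Finset.mem_Ioc] at hi
  have := Finset.mem_range.mp (hW hi.2)
  exact Finset.card_pair (by omega)

/-- The number of `i` both of whose summands lie in `S`. -/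
def hits (N n : ℕ) (W S : Finset ℕ) : ℝ :=
  ∑ i ∈ Ioc N (2 * N) ×ˢ W, if summands n i ⊆ S then 1 else 0

lemma avg_hits (ht : 0 < t) (hn : 6 * N ≤ n) (hn' : n < 12 * N) (hW : W ⊆ range (N + 1)) :
    avg (range (12 * N + 1)) t (hits N n W) = N * W.card * (t / (1 + t)) ^ 2 := by
  unfold hits
  rw [avg_sum]
  rw [Finset.sum_congr rfl fun i hi => by
    rw [avg_superset ht (summands_subset hn' hi), card_summands hn hW hi]]
  rw [Finset.sum_const, Finset.card_product, Nat.card_Ioc, nsmul_eq_mul]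
  have : 2 * N - N = N := by omega
  rw [this]
  push_cast
  ring

lemma pow_card_summands_union_le {p : ℝ} (hp : 0 ≤ p) (hp1 : p ≤ 1) (hn : 6 * N ≤ n)
    (hW : W ⊆ range (N + 1)) {i j : ℕ × ℕ} (hi : i ∈ Ioc N (2 * N) ×ˢ W)
    (hj : j ∈ Ioc N (2 * N) ×ˢ W) :
    p ^ (summands n i ∪ summands n j).card ≤ p ^ 4 + (if i.1 = j.1 then p ^ 3 else 0) +
      (if i.1 + i.2 = j.1 + j.2 then p ^ 3 else 0) + (if i = j then p ^ 2 else 0) := by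
  have hp2 : 0 ≤ p ^ 2 := by positivity
  have hp3 : 0 ≤ p ^ 3 := by positivity
  have hp4 : 0 ≤ p ^ 4 := by positivity
  have ci := card_summands hn hW hi
  have cj := card_summands hn hW hj
  simp only [Finset.mem_product, Finset.mem_Ioc] at hi hj
  have hiW := Finset.mem_range.mp (hW hi.2)
  have hjW := Finset.mem_range.mp (hW hj.2)
  have n1 : 0 ≤ if i.1 = j.1 then p ^ 3 else 0 := by split_ifs <;> linarith
  have n2 : 0 ≤ if i.1 + i.2 = j.1 + j.2 then p ^ 3 else 0 := by split_ifs <;> linarith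
  have n3 : 0 ≤ if i = j then p ^ 2 else 0 := by split_ifs <;> linarith
  by_cases hij : i = j
  · subst hij
    rw [Finset.union_self, ci, if_pos rfl, if_pos rfl, if_pos rfl]
    linarith
  by_cases hlt : (summands n i ∪ summands n j).card = 4
  · rw [hlt]; linarith
  have h3 : p ^ (summands n i ∪ summands n j).card ≤ p ^ 3 := by
    refine pow_le_pow_of_le_one hp hp1 ?_
    by_contra! hlt3
    have e1 : summands n i = summands n i ∪ summands n j :=
      Finset.eq_of_subset_of_card_le Finset.subset_union_left (by omega)
    have e2 : summands n j = summands n i ∪ summands n j :=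
      Finset.eq_of_subset_of_card_le Finset.subset_union_right (by omega)
    have e3 : summands n i = summands n j := e1.trans e2.symm
    apply hij
    have m1 : i.1 ∈ summands n j := by rw [← e3]; simp [summands]
    have m2 : n - i.2 - i.1 ∈ summands n j := by rw [← e3]; simp [summands]
    simp only [summands, Finset.mem_insert, Finset.mem_singleton] at m1 m2
    ext <;> omega
  by_cases h1 : i.1 = j.1
  · rw [if_pos h1] at n1 ⊢; linarith
  by_cases h2 : i.1 + i.2 = j.1 + j.2
  · rw [if_pos h2] at n2 ⊢; linarith
  exfalso
  apply hlt
  rw [Finset.card_union_of_disjoint, ci, cj]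
  rw [Finset.disjoint_left]
  intro x hx hx'
  simp only [summands, Finset.mem_insert, Finset.mem_singleton] at hx hx'
  omega

lemma avg_hits_sq (ht : 0 < t) (hn : 6 * N ≤ n) (hn' : n < 12 * N) (hW : W ⊆ range (N + 1)) :
    avg (range (12 * N + 1)) t (fun S => hits N n W S ^ 2) ≤
      (N * W.card * (t / (1 + t)) ^ 2) ^ 2 + N * W.card * (t / (1 + t)) ^ 2 +
        2 * N * W.card ^ 2 * (t / (1 + t)) ^ 3 := by
  set p := t / (1 + t) with hp
  have hp0 : 0 ≤ p := by positivity
  have hp1 : p ≤ 1 := (div_le_one (by positivity)).mpr (by linarith)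
  set I := Ioc N (2 * N) ×ˢ W with hI
  have hIc : (I.card : ℝ) = N * W.card := by
    rw [hI, Finset.card_product, Nat.card_Ioc]
    have : 2 * N - N = N := by omega
    rw [this]
    push_cast
    ring
  have e1 : ∀ S, hits N n W S ^ 2 =
      ∑ i ∈ I, ∑ j ∈ I, if summands n i ∪ summands n j ⊆ S then (1 : ℝ) else 0 := by
    intro S
    rw [sq, hits, Finset.sum_mul_sum]
    refine Finset.sum_congr rfl fun i _ => Finset.sum_congr rfl fun j _ => ?_
    simp only [Finset.union_subset_iff, ite_and]
    split_ifs <;> simp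
  simp only [e1]
  rw [avg_sum]
  simp only [avg_sum]
  have hrow : ∀ i ∈ I, ∑ j ∈ I, avg (range (12 * N + 1)) t
      (fun S => if summands n i ∪ summands n j ⊆ S then (1 : ℝ) else 0) ≤
      N * W.card * p ^ 4 + W.card * p ^ 3 + W.card * p ^ 3 + p ^ 2 := by
    intro i hi
    have : ∀ j ∈ I, avg (range (12 * N + 1)) t
        (fun S => if summands n i ∪ summands n j ⊆ S then (1 : ℝ) else 0) ≤
        p ^ 4 + (if i.1 = j.1 then p ^ 3 else 0) +
          (if i.1 + i.2 = j.1 + j.2 then p ^ 3 else 0) + (if i = j then p ^ 2 else 0) := by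
      intro j hj
      rw [avg_superset ht (Finset.union_subset (summands_subset hn' hi) (summands_subset hn' hj))]
      exact pow_card_summands_union_le hp0 hp1 hn hW hi hj
    refine (Finset.sum_le_sum this).trans ?_
    simp only [Finset.sum_add_distrib, Finset.sum_const, ← Finset.sum_filter, nsmul_eq_mul]
    rw [hIc]
    have c1 : ((I.filter fun j => i.1 = j.1).card : ℝ) ≤ W.card := by
      norm_cast
      refine Finset.card_le_card_of_injOn Prod.snd ?_ ?_
      · intro j hj
        exact (Finset.mem_product.mp (Finset.mem_filter.mp hj).1).2
      · intro j hj k hk h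
        have := (Finset.mem_filter.mp hj).2
        have := (Finset.mem_filter.mp hk).2
        ext
        · omega
        · exact h
    have c2 : ((I.filter fun j => i.1 + i.2 = j.1 + j.2).card : ℝ) ≤ W.card := by
      norm_cast
      refine Finset.card_le_card_of_injOn Prod.snd ?_ ?_
      · intro j hj
        exact (Finset.mem_product.mp (Finset.mem_filter.mp hj).1).2
      · intro j hj k hk h
        have := (Finset.mem_filter.mp hj).2
        have := (Finset.mem_filter.mp hk).2
        ext
        · omega
        · exact h
    have c3 : ((I.filter fun j => i = j).card : ℝ) ≤ 1 := by
      norm_cast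
      rw [Finset.card_le_one]
      intro j hj k hk
      exact (Finset.mem_filter.mp hj).2.symm.trans (Finset.mem_filter.mp hk).2
    have c4 : ((I.filter fun j => i = j).card : ℝ) * p ^ 2 ≤ 1 * p ^ 2 := by gcongr
    gcongr
    linarith
  refine (Finset.sum_le_sum hrow).trans (le_of_eq ?_)
  rw [Finset.sum_const, nsmul_eq_mul, hIc]
  ring

lemma avg_hits_sub_sq (ht : 0 < t) (hn : 6 * N ≤ n) (hn' : n < 12 * N)
    (hW : W ⊆ range (N + 1)) :
    avg (range (12 * N + 1)) t (fun S => (hits N n W S - N * W.card * (t / (1 + t)) ^ 2) ^ 2) ≤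
      N * W.card * (t / (1 + t)) ^ 2 + 2 * N * W.card ^ 2 * (t / (1 + t)) ^ 3 := by
  set μ : ℝ := N * W.card * (t / (1 + t)) ^ 2 with hμ
  have e : ∀ S, (hits N n W S - μ) ^ 2 = hits N n W S ^ 2 + (-2 * μ * hits N n W S + μ ^ 2) :=
    fun S => by ring
  simp only [e]
  rw [avg_add, avg_add, avg_const_mul, avg_const ht, avg_hits ht hn hn' hW, ← hμ]
  have := avg_hits_sq ht hn hn' hW
  rw [← hμ] at this
  linarith

end SecondMoment

section Damage

variable {N n g : ℕ} {t z F ρ cap : ℝ} {A W : Finset ℕ}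

open Classical in
/-- The number of `i` with both summands in `S`, one of them bad in `A ∪ S`; it is counted only
when the potential is at most `F`. -/
def damage (N n g : ℕ) (z F : ℝ) (A W S : Finset ℕ) : ℝ :=
  ∑ i ∈ Ioc N (2 * N) ×ˢ W, if summands n i ⊆ S ∧
    (IsBad (A ∪ S) g i.1 ∨ IsBad (A ∪ S) g (n - i.2 - i.1)) ∧ potential N z (A ∪ S) ≤ F
    then 1 else 0

/-- The number of summands of `i` that are suspects in `A ∪ S`. -/
def suspicion (N n g : ℕ) (z F : ℝ) (A : Finset ℕ) (i : ℕ × ℕ) (S : Finset ℕ) : ℝ :=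
  if potential N z (A ∪ S) ≤ F then
    (if i.1 ∈ suspects N g (A ∪ S) (n - i.2) then 1 else 0) +
      (if n - i.2 - i.1 ∈ suspects N g (A ∪ S) (n - i.2) then 1 else 0)
  else 0

lemma suspicion_nonneg (i : ℕ × ℕ) (S : Finset ℕ) : 0 ≤ suspicion N n g z F A i S := by
  unfold suspicion
  split_ifs <;> norm_num

lemma avg_reps_nonempty_le {J : Finset ℕ} {m : ℕ} (hA : A ⊆ J) (ht : 0 < t)
    (hm : reps A m = ∅) :
    avg J t (fun S => if (reps (A ∪ S) m).Nonempty then 1 else 0) ≤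
      ∑ x ∈ newPairs A J m, t ^ (missing A m x).card := by
  have h : ∀ S ⊆ J, (if (reps (A ∪ S) m).Nonempty then (1 : ℝ) else 0) ≤
      ∑ x ∈ newPairs A J m, if missing A m x ⊆ S then 1 else 0 := by
    intro S hS
    have hc := reps_union (m := m) hA hS
    rw [hm, Finset.card_empty, zero_add] at hc
    rw [Finset.sum_boole, ← hc]
    split_ifs with h
    · exact_mod_cast Finset.card_pos.mpr h
    · positivity
  refine (avg_mono ht h).trans ?_
  rw [avg_sum]
  exact Finset.sum_le_sum fun x hx => avg_superset_le_pow ht (missing_subset hx)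

lemma sum_suspicion_le {S : Finset ℕ} (hn : 6 * N ≤ n) (hW : W ⊆ range (N + 1))
    (hcap0 : 0 ≤ cap)
    (hcap : potential N z (A ∪ S) ≤ F → ∀ s, ((suspects N g (A ∪ S) s).card : ℝ) ≤ cap) :
    ∑ i ∈ Ioc N (2 * N) ×ˢ W, suspicion N n g z F A i S ≤ W.card * (2 * cap) := by
  rw [Finset.sum_product_right, ← nsmul_eq_mul, ← Finset.sum_const]
  refine Finset.sum_le_sum fun w hw => ?_
  unfold suspicion
  by_cases hF : potential N z (A ∪ S) ≤ F
  · simp only [if_pos hF, Finset.sum_add_distrib, Finset.sum_boole]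
    have h1 : (((Ioc N (2 * N)).filter fun a => a ∈ suspects N g (A ∪ S) (n - w)).card : ℝ) ≤
        (suspects N g (A ∪ S) (n - w)).card := by
      exact_mod_cast Finset.card_le_card fun a ha => (Finset.mem_filter.mp ha).2
    have h2 : (((Ioc N (2 * N)).filter
        fun a => n - w - a ∈ suspects N g (A ∪ S) (n - w)).card : ℝ) ≤
        (suspects N g (A ∪ S) (n - w)).card := by
      norm_cast
      refine Finset.card_le_card_of_injOn (fun a => n - w - a)
        (fun a ha => (Finset.mem_filter.mp ha).2) ?_
      intro a ha b hb hab
      have := Finset.mem_Ioc.mp (Finset.mem_filter.mp ha).1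
      have := Finset.mem_Ioc.mp (Finset.mem_filter.mp hb).1
      have := Finset.mem_range.mp (hW hw)
      simp only at hab
      omega
    have h3 := hcap hF (n - w)
    linarith
  · simp only [if_neg hF, Finset.sum_const_zero]
    positivity

lemma avg_damage_le (hA : A ⊆ range (12 * N + 1)) (ht : 0 < t) (hz : 1 ≤ z) (hg : 2 ≤ g)
    (hn : 6 * N ≤ n) (hn' : n < 12 * N) (hW : W ⊆ range (N + 1))
    (hrep : ∀ w ∈ W, reps A (n - w) = ∅)
    (hρ : ∀ m, ∑ x ∈ newPairs A (range (12 * N + 1)) m, t ^ (missing A m x).card ≤ ρ)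
    (hcap0 : 0 ≤ cap)
    (hcap : ∀ C ⊆ range (12 * N + 1), potential N z C ≤ F →
      ∀ s, ((suspects N g C s).card : ℝ) ≤ cap) :
    avg (range (12 * N + 1)) t (damage N n g z F A W) ≤ W.card * t ^ 2 * (N * ρ + 2 * cap) := by
  set J := range (12 * N + 1) with hJ
  set I := Ioc N (2 * N) ×ˢ W with hI
  let H : ℕ × ℕ → Finset ℕ → ℝ := fun i S =>
    (if (reps (A ∪ S) (n - i.2)).Nonempty then 1 else 0) + suspicion N n g z F A i S
  have hH0 : ∀ i S, 0 ≤ H i S := fun i S =>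
    add_nonneg (by split_ifs <;> norm_num) (suspicion_nonneg i S)
  have hpt : ∀ S ⊆ J, damage N n g z F A W S ≤
      ∑ i ∈ I, if summands n i ⊆ S then H i (S \ summands n i) else 0 := by
    intro S hS
    unfold damage
    refine Finset.sum_le_sum fun i hi => ?_
    by_cases hD : summands n i ⊆ S
    swap
    · rw [if_neg hD, if_neg (fun h => hD h.1)]
    rw [if_pos hD]
    split_ifs with h
    swap
    · exact hH0 _ _
    obtain ⟨-, hbad, hF⟩ := h
    have hC : A ∪ S = (A ∪ S \ summands n i) ∪ {i.1, n - i.2 - i.1} := by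
      conv_lhs => rw [← Finset.sdiff_union_of_subset hD, ← Finset.union_assoc]
      rfl
    have hF' : potential N z (A ∪ S \ summands n i) ≤ F :=
      (potential_mono hz (Finset.union_subset_union_right Finset.sdiff_subset)).trans hF
    have hsJ := summands_subset hn' hi
    simp only [H]
    have hnn : ∀ c : ℝ, 0 ≤ c → (1 : ℝ) ≤ 1 + c := fun c hc => by linarith
    by_cases hne : (reps (A ∪ S \ summands n i) (n - i.2)).Nonempty
    · rw [if_pos hne]
      exact hnn _ (suspicion_nonneg _ _)
    rw [if_neg hne, zero_add]
    unfold suspicion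
    rw [if_pos hF']
    have hi' := hi
    simp only [Finset.mem_product, Finset.mem_Ioc] at hi'
    have hw := Finset.mem_range.mp (hW hi'.2)
    rcases hbad with hbad | hbad
    · rw [hC] at hbad
      have := hbad.pair (N := N) hg (hsJ (by simp [summands]))
      rw [show i.1 + (n - i.2 - i.1) = n - i.2 by omega] at this
      rw [if_pos (this.resolve_left hne)]
      exact hnn _ (by split_ifs <;> norm_num)
    · rw [hC, Finset.pair_comm] at hbad
      have := hbad.pair (N := N) hg (hsJ (by simp [summands]))
      rw [show (n - i.2 - i.1) + i.1 = n - i.2 by omega] at this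
      rw [if_pos (this.resolve_left hne), add_comm]
      exact hnn _ (by split_ifs <;> norm_num)
  refine (avg_mono ht hpt).trans ?_
  rw [avg_sum]
  have hterm : ∀ i ∈ I, avg J t
      (fun S => if summands n i ⊆ S then H i (S \ summands n i) else 0) ≤
      t ^ 2 * (ρ + avg J t (suspicion N n g z F A i)) := by
    intro i hi
    refine (avg_superset_le ht (summands_subset hn' hi) (hH0 i)).trans ?_
    rw [card_summands hn hW hi, avg_add]
    gcongr
    refine (avg_reps_nonempty_le hA ht (hrep _ (Finset.mem_product.mp hi).2)).trans (hρ _)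
  refine (Finset.sum_le_sum hterm).trans ?_
  rw [← Finset.mul_sum, Finset.sum_add_distrib, ← avg_sum, Finset.sum_const, nsmul_eq_mul]
  have hIc : (I.card : ℝ) = N * W.card := by
    rw [hI, Finset.card_product, Nat.card_Ioc]
    have : 2 * N - N = N := by omega
    rw [this]
    push_cast
    ring
  have hs : avg J t (fun S => ∑ i ∈ I, suspicion N n g z F A i S) ≤ W.card * (2 * cap) := by
    refine (avg_mono ht fun S hS => ?_).trans_eq (avg_const ht _)
    exact sum_suspicion_le hn hW hcap0 (hcap _ (Finset.union_subset hA hS))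
  rw [hIc]
  calc _ ≤ t ^ 2 * (N * W.card * ρ + W.card * (2 * cap)) := by gcongr
    _ = _ := by ring

end Damage

open Classical in
/-- `A ∪ S` without the bad elements of `S`. -/
def repair (A S : Finset ℕ) (g : ℕ) : Finset ℕ := A ∪ S.filter fun a => ¬ IsBad (A ∪ S) g a

/-- `n` is a sum of two elements of `A` and one of `W`. -/
def Covers (A W : Finset ℕ) (n : ℕ) : Prop := ∃ a ∈ A, ∃ b ∈ A, ∃ w ∈ W, n = a + b + w

lemma Covers.mono {A A' W : Finset ℕ} {n : ℕ} (h : A ⊆ A') : Covers A W n → Covers A' W n :=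
  fun ⟨a, ha, b, hb, w, hw, e⟩ => ⟨a, h ha, b, h hb, w, hw, e⟩

lemma repair_subset (A S : Finset ℕ) (g : ℕ) : repair A S g ⊆ A ∪ S := by
  classical
  exact Finset.union_subset_union_right (Finset.filter_subset _ _)

lemma card_reps_repair_le {A S : Finset ℕ} {g : ℕ} (hA : ∀ m, (reps A m).card ≤ g) (m : ℕ) :
    (reps (repair A S g) m).card ≤ g := by
  by_contra! hlt
  have hlt' : g < (reps (A ∪ S) m).card :=
    hlt.trans_le (Finset.card_le_card (reps_mono (repair_subset A S g) m))
  have hgood : ∀ x ∈ repair A S g, x ≤ m → m - x ∈ repair A S g → x ∈ A := by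
    intro x hx hxm hmx
    by_contra hxA
    simp only [repair, Finset.mem_union, hxA, false_or, Finset.mem_filter] at hx
    refine hx.2 ⟨m - x, repair_subset A S g hmx, ?_⟩
    rwa [Nat.add_sub_cancel' hxm]
  have hsub : reps (repair A S g) m ⊆ reps A m := by
    intro x hx
    simp only [reps, Finset.mem_filter, Finset.mem_range] at hx ⊢
    refine ⟨hx.1, hx.2.1, hgood x hx.2.2.1 (by omega) hx.2.2.2,
      hgood (m - x) hx.2.2.2 (by omega) ?_⟩
    rw [Nat.sub_sub_self (by omega)]
    exact hx.2.2.1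
  exact absurd (Finset.card_le_card hsub) (by have := hA m; omega)

section Round

variable {N n g : ℕ} {t z F ρ cap : ℝ} {A W : Finset ℕ}

lemma hits_le_damage {S : Finset ℕ} (hn : 6 * N ≤ n) (hW : W ⊆ range (N + 1))
    (hcov : ¬ Covers (repair A S g) W n) (hF : potential N z (A ∪ S) ≤ F) :
    hits N n W S ≤ damage N n g z F A W S := by
  classical
  unfold hits damage
  refine Finset.sum_le_sum fun i hi => ?_
  by_cases hD : summands n i ⊆ S
  swap
  · rw [if_neg hD]
    split_ifs <;> norm_num
  rw [if_pos hD, if_pos]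
  refine ⟨hD, ?_, hF⟩
  by_contra! hbad
  have hi' := Finset.mem_product.mp hi
  have h1 := Finset.mem_Ioc.mp hi'.1
  have h2 := Finset.mem_range.mp (hW hi'.2)
  refine hcov ⟨i.1, ?_, n - i.2 - i.1, ?_, i.2, hi'.2, by omega⟩
  · exact Finset.mem_union_right _
      (Finset.mem_filter.mpr ⟨hD (by simp [summands]), hbad.1⟩)
  · exact Finset.mem_union_right _
      (Finset.mem_filter.mpr ⟨hD (by simp [summands]), hbad.2⟩)

/-- This dominates the indicator of the event that `n` stays uncovered while the potential is at
most `F`. -/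
def defect (N n g : ℕ) (z F μ : ℝ) (A W S : Finset ℕ) : ℝ :=
  4 / μ ^ 2 * (hits N n W S - μ) ^ 2 + 2 / μ * damage N n g z F A W S

lemma damage_nonneg {S : Finset ℕ} : 0 ≤ damage N n g z F A W S :=
  Finset.sum_nonneg fun _ _ => by split_ifs <;> norm_num

lemma defect_nonneg {μ : ℝ} (hμ : 0 < μ) {S : Finset ℕ} : 0 ≤ defect N n g z F μ A W S := by
  have := damage_nonneg (N := N) (n := n) (g := g) (z := z) (F := F) (A := A) (W := W) (S := S)
  unfold defect
  positivity

lemma one_le_defect {μ : ℝ} (hμ : 0 < μ) {S : Finset ℕ} (hn : 6 * N ≤ n)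
    (hW : W ⊆ range (N + 1)) (hcov : ¬ Covers (repair A S g) W n)
    (hF : potential N z (A ∪ S) ≤ F) : 1 ≤ defect N n g z F μ A W S := by
  have h1 := hits_le_damage hn hW hcov hF
  have h0 := damage_nonneg (N := N) (n := n) (g := g) (z := z) (F := F) (A := A) (W := W) (S := S)
  unfold defect
  rw [div_mul_eq_mul_div, div_mul_eq_mul_div]
  rcases le_total (hits N n W S) (μ / 2) with h | h
  · have h2 : 1 ≤ 4 * (hits N n W S - μ) ^ 2 / μ ^ 2 := by
      rw [le_div_iff₀ (by positivity)]
      nlinarith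
    have h3 : 0 ≤ 2 * damage N n g z F A W S / μ := by positivity
    linarith
  · have h2 : 1 ≤ 2 * damage N n g z F A W S / μ := by
      rw [le_div_iff₀ hμ]
      linarith
    have h3 : 0 ≤ 4 * (hits N n W S - μ) ^ 2 / μ ^ 2 := by positivity
    linarith

lemma reps_eq_empty_of_not_covers {w : ℕ} (hn : w ≤ n) (hw : w ∈ W) (h : ¬ Covers A W n) :
    reps A (n - w) = ∅ := by
  rw [Finset.eq_empty_iff_forall_notMem]
  intro x hx
  simp only [reps, Finset.mem_filter] at hx
  exact h ⟨x, hx.2.2.1, n - w - x, hx.2.2.2, w, hw, by omega⟩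

lemma avg_potential_le (hA : A ⊆ range (12 * N + 1)) (ht : 0 < t) (hz : 1 ≤ z)
    (hρ : ∀ m, ∑ x ∈ newPairs A (range (12 * N + 1)) m, t ^ (missing A m x).card ≤ ρ) :
    avg (range (12 * N + 1)) t (fun S => potential N z (A ∪ S)) ≤
      potential N z A * Real.exp (z * ρ) := by
  unfold potential
  rw [avg_sum, Finset.sum_mul]
  refine Finset.sum_le_sum fun m _ => (avg_pow_reps_le hA ht hz).trans ?_
  gcongr
  exact hρ m

lemma potential_pos (hz : 0 < z) : 0 < potential N z A :=
  Finset.sum_pos (fun _ _ => by positivity) (by simp)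

/-- One random round covers all but a small proportion of the uncovered `n`. -/
lemma exists_round {η F₀ Δ μ : ℝ} {E : Finset ℕ} (hA : A ⊆ range (12 * N + 1))
    (hAg : ∀ m, (reps A m).card ≤ g) (hg : 2 ≤ g) (ht : 0 < t) (hz : 1 ≤ z)
    (hW : W ⊆ range (N + 1)) (hE : ∀ n ∈ E, 6 * N ≤ n ∧ n < 12 * N ∧ ¬ Covers A W n)
    (hρ : ∀ m, ∑ x ∈ newPairs A (range (12 * N + 1)) m, t ^ (missing A m x).card ≤ ρ)
    (hcap0 : 0 ≤ cap)
    (hcap : ∀ C ⊆ range (12 * N + 1), potential N z C ≤ F₀ + Δ →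
      ∀ s, ((suspects N g C s).card : ℝ) ≤ cap)
    (hμ : μ = N * W.card * (t / (1 + t)) ^ 2) (hμ0 : 0 < μ)
    (hF : potential N z A ≤ F₀) (hΔ : 0 < Δ) (hexp : F₀ * (Real.exp (z * ρ) - 1) ≤ Δ / 4)
    (hη : 0 < η)
    (hτ : 4 / μ ^ 2 * (μ + 2 * N * W.card ^ 2 * (t / (1 + t)) ^ 3) +
      2 / μ * (W.card * t ^ 2 * (N * ρ + 2 * cap)) ≤ η / 4) :
    ∃ A', A ⊆ A' ∧ A' ⊆ range (12 * N + 1) ∧ (∀ m, (reps A' m).card ≤ g) ∧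
      potential N z A' ≤ potential N z A + Δ ∧
      ∃ E' ⊆ E, (∀ n ∈ E, n ∉ E' → Covers A' W n) ∧ (∀ n ∈ E', ¬ Covers A' W n) ∧
        (E'.card : ℝ) ≤ η * E.card := by
  classical
  rcases E.eq_empty_or_nonempty with rfl | hEne
  · exact ⟨A, subset_rfl, hA, hAg, by linarith, ∅, subset_rfl, by simp, by simp, by simp⟩
  have hEc : (0 : ℝ) < E.card := by exact_mod_cast hEne.card_pos
  set J := range (12 * N + 1) with hJ
  have hdef : ∀ n ∈ E, avg J t (defect N n g z (F₀ + Δ) μ A W) ≤ η / 4 := by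
    intro n hn
    obtain ⟨h6, h12, hcov⟩ := hE n hn
    have h1 := avg_hits_sub_sq ht h6 h12 hW
    have h2 := avg_damage_le (F := F₀ + Δ) hA ht hz hg h6 h12 hW
      (fun w hw => reps_eq_empty_of_not_covers
        (by have := Finset.mem_range.mp (hW hw); omega) hw hcov) hρ hcap0 hcap
    unfold defect
    rw [avg_add, avg_const_mul, avg_const_mul]
    refine le_trans ?_ hτ
    rw [← hμ] at h1
    gcongr
  have hpot := avg_potential_le hA ht hz hρ
  set P := potential N z A with hP
  have havg : avg J t (fun S => (1 / Δ * potential N z (A ∪ S) + -(P / Δ)) +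
      1 / (η * E.card) * ∑ n ∈ E, defect N n g z (F₀ + Δ) μ A W S) < 1 := by
    rw [avg_add, avg_add, avg_const ht, avg_const_mul, avg_const_mul, avg_sum]
    have h1 : ∑ n ∈ E, avg J t (defect N n g z (F₀ + Δ) μ A W) ≤ E.card * (η / 4) := by
      refine (Finset.sum_le_sum hdef).trans ?_
      rw [Finset.sum_const, nsmul_eq_mul]
    have h2 : 1 / (η * E.card) * ∑ n ∈ E, avg J t (defect N n g z (F₀ + Δ) μ A W) ≤ 1 / 4 := by
      rw [div_mul_eq_mul_div, div_le_iff₀ (by positivity)]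
      linarith
    have hP0 : 0 < P := potential_pos (by linarith)
    have h4 : P * (Real.exp (z * ρ) - 1) ≤ Δ / 4 := by
      rcases le_total 0 (Real.exp (z * ρ) - 1) with h | h
      · exact (mul_le_mul_of_nonneg_right hF h).trans hexp
      · exact (mul_nonpos_of_nonneg_of_nonpos hP0.le h).trans (by positivity)
    have h3 : 1 / Δ * avg J t (fun S => potential N z (A ∪ S)) + -(P / Δ) ≤ 1 / 4 := by
      have : 1 / Δ * avg J t (fun S => potential N z (A ∪ S)) + -(P / Δ) =
          (avg J t (fun S => potential N z (A ∪ S)) - P) / Δ := by ring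
      rw [this, div_le_iff₀ hΔ]
      linarith
    linarith
  obtain ⟨S, hS, hlt⟩ := exists_lt_of_avg_lt ht havg
  have hmono : P ≤ potential N z (A ∪ S) := potential_mono hz Finset.subset_union_left
  have hsum0 : 0 ≤ ∑ n ∈ E, defect N n g z (F₀ + Δ) μ A W S :=
    Finset.sum_nonneg fun _ _ => defect_nonneg hμ0
  have e1 : 1 / Δ * potential N z (A ∪ S) + -(P / Δ) = (potential N z (A ∪ S) - P) / Δ := by ring
  rw [e1] at hlt
  have hq1 : 0 ≤ (potential N z (A ∪ S) - P) / Δ := div_nonneg (by linarith) hΔ.le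
  have hq2 : 0 ≤ 1 / (η * E.card) * ∑ n ∈ E, defect N n g z (F₀ + Δ) μ A W S := by positivity
  have hb1 : potential N z (A ∪ S) ≤ P + Δ := by
    have : (potential N z (A ∪ S) - P) / Δ ≤ 1 := by linarith
    rw [div_le_iff₀ hΔ] at this
    linarith
  have hb2 : ∑ n ∈ E, defect N n g z (F₀ + Δ) μ A W S ≤ η * E.card := by
    have : 1 / (η * E.card) * ∑ n ∈ E, defect N n g z (F₀ + Δ) μ A W S ≤ 1 := by linarith
    rw [div_mul_eq_mul_div, div_le_iff₀ (by positivity)] at this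
    linarith
  refine ⟨repair A S g, Finset.subset_union_left,
    (repair_subset A S g).trans (Finset.union_subset hA hS), card_reps_repair_le hAg,
    (potential_mono hz (repair_subset A S g)).trans hb1,
    E.filter fun n => ¬ Covers (repair A S g) W n, Finset.filter_subset _ _, ?_, ?_, ?_⟩
  · intro n hn hn'
    by_contra h
    exact hn' (Finset.mem_filter.mpr ⟨hn, h⟩)
  · exact fun n hn => (Finset.mem_filter.mp hn).2
  · refine le_trans ?_ hb2
    rw [Finset.card_eq_sum_ones, Nat.cast_sum]
    refine (Finset.sum_le_sum fun n hn => ?_).trans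
      (Finset.sum_le_sum_of_subset_of_nonneg (Finset.filter_subset _ _)
        fun _ _ _ => defect_nonneg hμ0)
    rw [Finset.mem_filter] at hn
    rw [Nat.cast_one]
    exact one_le_defect hμ0 (hE n hn.1).1 hW hn.2 (hb1.trans (by linarith))

end Round

/-- An upper bound for the size of a set whose potential is at most `102 N`. -/
def sizeBound (N : ℕ) (z : ℝ) : ℝ := √(204 * N / z)

/-- An upper bound for the expected number of new representations of a number. -/
def newRepsBound (N : ℕ) (t z : ℝ) : ℝ := (12 * N + 1) * t ^ 2 + (2 * sizeBound N z + 1) * t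

/-- An upper bound for the number of suspects in a set whose potential is at most `102 N`. -/
def suspectsBound (N g : ℕ) (z : ℝ) : ℝ :=
  3 * sizeBound N z ^ 2 + sizeBound N z * (102 * N / z ^ g)

section Stage

variable {N g T : ℕ} {t z η : ℝ} {W : Finset ℕ}

lemma card_le_sizeBound {C : Finset ℕ} (hz : 2 ≤ z) (hC : C ⊆ range (12 * N + 1))
    (hpot : potential N z C ≤ 102 * N) : (C.card : ℝ) ≤ sizeBound N z := by
  refine Real.le_sqrt_of_sq_le ?_
  rw [le_div_iff₀ (by linarith)]
  linarith [mul_card_sq_le_potential hz hC]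

lemma card_suspects_le_suspectsBound {C : Finset ℕ} (hz : 2 ≤ z) (hC : C ⊆ range (12 * N + 1))
    (hpot : potential N z C ≤ 102 * N) (s : ℕ) :
    ((suspects N g C s).card : ℝ) ≤ suspectsBound N g z := by
  have h1 := card_le_sizeBound hz hC hpot
  have h2 := (card_rich_mul_le_potential (g := g) (by linarith : 1 ≤ z) C).trans hpot
  rw [← le_div_iff₀ (by positivity)] at h2
  have h3 : ((suspects N g C s).card : ℝ) ≤ 3 * (C.card : ℝ) ^ 2 + C.card * (rich N g C).card := by
    exact_mod_cast card_suspects_le hC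
  have h4 : 0 ≤ sizeBound N z := Real.sqrt_nonneg _
  refine h3.trans ?_
  unfold suspectsBound
  gcongr

lemma exists_rounds {μ : ℝ} (hN : 0 < N) (hg : 2 ≤ g) (hT : 0 < T) (ht : 0 < t) (ht1 : t ≤ 1)
    (hz : 2 ≤ z) (hW : W ⊆ range (N + 1)) (hW0 : W.Nonempty)
    (hμ : μ = N * W.card * (t / (1 + t)) ^ 2) (hη : 0 < η)
    (hexp : 101 * N * (Real.exp (z * newRepsBound N t z) - 1) ≤ N / T / 4)
    (hτ : 4 / μ ^ 2 * (μ + 2 * N * W.card ^ 2 * (t / (1 + t)) ^ 3) +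
      2 / μ * (W.card * t ^ 2 * (N * newRepsBound N t z + 2 * suspectsBound N g z)) ≤ η / 4)
    {A : Finset ℕ} (hA : A ⊆ range (12 * N + 1)) (hAg : ∀ m, (reps A m).card ≤ g)
    (hF : potential N z A ≤ 100 * N) (j : ℕ) (hj : j ≤ T) :
    ∃ A', A ⊆ A' ∧ A' ⊆ range (12 * N + 1) ∧ (∀ m, (reps A' m).card ≤ g) ∧
      potential N z A' ≤ 100 * N + j * (N / T) ∧
      ∃ E' ⊆ Ico (6 * N) (12 * N), (∀ n ∈ Ico (6 * N) (12 * N), n ∉ E' → Covers A' W n) ∧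
        (∀ n ∈ E', ¬ Covers A' W n) ∧ (E'.card : ℝ) ≤ η ^ j * (6 * N) := by
  classical
  have hN' : (0 : ℝ) < N := by exact_mod_cast hN
  have hT' : (0 : ℝ) < T := by exact_mod_cast hT
  have hWc : (0 : ℝ) < W.card := by exact_mod_cast hW0.card_pos
  have hμ0 : 0 < μ := by rw [hμ]; positivity
  have hs0 : 0 ≤ sizeBound N z := Real.sqrt_nonneg _
  induction j with
  | zero =>
    refine ⟨A, subset_rfl, hA, hAg, by simpa using hF,
      (Ico (6 * N) (12 * N)).filter fun n => ¬ Covers A W n, Finset.filter_subset _ _, ?_, ?_, ?_⟩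
    · intro n hn hn'
      by_contra h
      exact hn' (Finset.mem_filter.mpr ⟨hn, h⟩)
    · exact fun n hn => (Finset.mem_filter.mp hn).2
    · have h1 := Finset.card_filter_le (Ico (6 * N) (12 * N)) fun n => ¬ Covers A W n
      rw [Nat.card_Ico] at h1
      rw [pow_zero, one_mul]
      exact_mod_cast h1.trans (by omega)
  | succ j ih =>
    obtain ⟨A₁, hAA₁, hA₁, hA₁g, hpot, E, hEsub, hEcov, hEun, hEcard⟩ := ih (by omega)
    have hjT : (j : ℝ) * (N / T) ≤ N := by
      have : (j : ℝ) ≤ T := by exact_mod_cast (by omega : j ≤ T)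
      rw [← mul_div_assoc, div_le_iff₀ hT', mul_comm]
      gcongr
    have hNT : (N : ℝ) / T ≤ N := div_le_self hN'.le (by exact_mod_cast hT)
    have hF₀ : potential N z A₁ ≤ 101 * N := by linarith
    have hc := card_le_sizeBound hz hA₁ (by linarith : potential N z A₁ ≤ 102 * N)
    obtain ⟨A₂, hA₁₂, hA₂, hA₂g, hpot₂, E', hE'sub, hE'cov, hE'un, hE'card⟩ :=
      exists_round (N := N) (g := g) (t := t) (z := z) (ρ := newRepsBound N t z)
        (cap := suspectsBound N g z) (E := E) (F₀ := 101 * N) (Δ := N / T) (μ := μ) (η := η)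
        hA₁ hA₁g hg ht (by linarith) hW
        (fun n hn => ⟨(Finset.mem_Ico.mp (hEsub hn)).1, (Finset.mem_Ico.mp (hEsub hn)).2,
          hEun n hn⟩)
        (fun m => by
          refine (sum_missing_le ht ht1).trans ?_
          rw [Finset.card_range, newRepsBound]
          push_cast
          gcongr)
        (by unfold suspectsBound; positivity)
        (fun C hC hp s => card_suspects_le_suspectsBound hz hC (by linarith) s)
        hμ hμ0 hF₀ (by positivity) hexp hη hτ
    refine ⟨A₂, hAA₁.trans hA₁₂, hA₂, hA₂g, ?_, E', hE'sub.trans hEsub, ?_, hE'un, ?_⟩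
    · push_cast
      linarith
    · intro n hn hn'
      by_cases h : n ∈ E
      · exact hE'cov n h hn'
      · exact (hEcov n hn h).mono hA₁₂
    · refine hE'card.trans ?_
      rw [pow_succ', mul_assoc]
      gcongr

/-- All the rounds at one scale. -/
lemma exists_stage {μ : ℝ} (hN : 0 < N) (hg : 2 ≤ g) (hT : 0 < T) (ht : 0 < t) (ht1 : t ≤ 1)
    (hz : 2 ≤ z) (hW : W ⊆ range (N + 1)) (hW0 : W.Nonempty)
    (hμ : μ = N * W.card * (t / (1 + t)) ^ 2) (hη : 0 < η)
    (hexp : 101 * N * (Real.exp (z * newRepsBound N t z) - 1) ≤ N / T / 4)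
    (hτ : 4 / μ ^ 2 * (μ + 2 * N * W.card ^ 2 * (t / (1 + t)) ^ 3) +
      2 / μ * (W.card * t ^ 2 * (N * newRepsBound N t z + 2 * suspectsBound N g z)) ≤ η / 4)
    (hfin : η ^ T * (6 * N) < 1)
    {A : Finset ℕ} (hA : A ⊆ range (12 * N + 1)) (hAg : ∀ m, (reps A m).card ≤ g)
    (hF : potential N z A ≤ 100 * N) :
    ∃ A', A ⊆ A' ∧ A' ⊆ range (12 * N + 1) ∧ (∀ m, (reps A' m).card ≤ g) ∧
      potential N z A' ≤ 101 * N ∧ ∀ n ∈ Ico (6 * N) (12 * N), Covers A' W n := by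
  obtain ⟨A', hAA', hA', hA'g, hpot, E', -, hcov, -, hcard⟩ :=
    exists_rounds hN hg hT ht ht1 hz hW hW0 hμ hη hexp hτ hA hAg hF T le_rfl
  have hT' : (T : ℝ) ≠ 0 := by exact_mod_cast hT.ne'
  have hE' : E' = ∅ := by
    have : (E'.card : ℝ) < 1 := hcard.trans_lt hfin
    rw [← Finset.card_eq_zero]
    exact Nat.lt_one_iff.mp (by exact_mod_cast this)
  refine ⟨A', hAA', hA', hA'g, ?_, fun n hn => hcov n hn (by simp [hE'])⟩
  rw [mul_div_cancel₀ _ hT'] at hpot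
  linarith

end Stage

lemma tail_bound_le {N w t ρ S : ℝ} (hN : 0 < N) (hw : 0 < w) (ht : 0 < t) (ht1 : t ≤ 1)
    (hρ : 0 ≤ N * ρ + 2 * S) :
    4 / (N * w * (t / (1 + t)) ^ 2) ^ 2 *
        (N * w * (t / (1 + t)) ^ 2 + 2 * N * w ^ 2 * (t / (1 + t)) ^ 3) +
      2 / (N * w * (t / (1 + t)) ^ 2) * (w * t ^ 2 * (N * ρ + 2 * S)) ≤
    16 / (N * w * t ^ 2) + 16 / (N * t) + 8 * ρ + 16 * (S / N) := by
  have hp : t / 2 ≤ t / (1 + t) := div_le_div_of_nonneg_left ht.le (by linarith) (by linarith)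
  set p := t / (1 + t) with hpdef
  have hp0 : 0 < p := by positivity
  have e : 4 / (N * w * p ^ 2) ^ 2 * (N * w * p ^ 2 + 2 * N * w ^ 2 * p ^ 3) +
      2 / (N * w * p ^ 2) * (w * t ^ 2 * (N * ρ + 2 * S)) =
      4 / (N * w * p ^ 2) + 8 / (N * p) + 2 * (t / p) ^ 2 * ((N * ρ + 2 * S) / N) := by
    field_simp
    ring
  rw [e]
  have h1 : 4 / (N * w * p ^ 2) ≤ 16 / (N * w * t ^ 2) := by
    have : 4 / (N * w * p ^ 2) ≤ 4 / (N * w * (t / 2) ^ 2) := by gcongr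
    refine this.trans_eq ?_
    field_simp
    norm_num
  have h2 : 8 / (N * p) ≤ 16 / (N * t) := by
    have : 8 / (N * p) ≤ 8 / (N * (t / 2)) := by gcongr
    refine this.trans_eq ?_
    field_simp
    norm_num
  have h3 : t / p ≤ 2 := by
    rw [div_le_iff₀ hp0]
    linarith
  have h4 : 2 * (t / p) ^ 2 * ((N * ρ + 2 * S) / N) ≤ 2 * 2 ^ 2 * ((N * ρ + 2 * S) / N) := by
    have : 0 ≤ (N * ρ + 2 * S) / N := div_nonneg hρ hN.le
    gcongr
  have h5 : (2 : ℝ) * 2 ^ 2 * ((N * ρ + 2 * S) / N) = 8 * ρ + 16 * (S / N) := by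
    field_simp
    ring
  linarith

section Asymptotics

variable {g : ℕ} {ζ ω ω' : ℝ} {N : ℕ}

lemma sizeBound_le (hN : 0 < N) :
    sizeBound N ((N : ℝ) ^ ζ) ≤ 15 * (N : ℝ) ^ ((1 - ζ) / 2) := by
  have hN' : (0 : ℝ) < N := by exact_mod_cast hN
  refine Real.sqrt_le_iff.mpr ⟨by positivity, ?_⟩
  rw [mul_pow, ← Real.rpow_natCast ((N : ℝ) ^ ((1 - ζ) / 2)), ← Real.rpow_mul hN'.le]
  have e : (1 - ζ) / 2 * ((2 : ℕ) : ℝ) = 1 - ζ := by push_cast; ring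
  rw [e, Real.rpow_sub hN', Real.rpow_one, mul_div_assoc]
  gcongr
  norm_num

lemma newRepsBound_le (hN : 0 < N) (hζ0 : 0 < ζ) (hζ1 : ζ < 1) (hζω : ζ < ω) :
    newRepsBound N ((N : ℝ) ^ (-(1 + ω) / 2)) ((N : ℝ) ^ ζ) ≤ 44 * (N : ℝ) ^ (-(ζ + ω) / 2) := by
  have hN1 : (1 : ℝ) ≤ N := by exact_mod_cast hN
  have hN' : (0 : ℝ) < N := by linarith
  have hs := sizeBound_le (ζ := ζ) hN
  have ht2 : ((N : ℝ) ^ (-(1 + ω) / 2)) ^ 2 = (N : ℝ) ^ (-(1 + ω)) := by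
    rw [← Real.rpow_natCast, ← Real.rpow_mul hN'.le]
    congr 1
    push_cast
    ring
  have h1 : (12 * (N : ℝ) + 1) * (N : ℝ) ^ (-(1 + ω)) ≤ 13 * (N : ℝ) ^ (-(ζ + ω) / 2) := by
    calc (12 * (N : ℝ) + 1) * (N : ℝ) ^ (-(1 + ω)) ≤ (13 * N) * (N : ℝ) ^ (-(1 + ω)) := by
          gcongr; linarith
      _ = 13 * (N : ℝ) ^ (1 + -(1 + ω)) := by
          rw [Real.rpow_add hN', Real.rpow_one]; ring
      _ ≤ 13 * (N : ℝ) ^ (-(ζ + ω) / 2) := by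
          gcongr
          linarith
  have h2 : (2 * sizeBound N ((N : ℝ) ^ ζ) + 1) * (N : ℝ) ^ (-(1 + ω) / 2) ≤
      31 * (N : ℝ) ^ (-(ζ + ω) / 2) := by
    have h3 : 1 ≤ (N : ℝ) ^ ((1 - ζ) / 2) := Real.one_le_rpow hN1 (by linarith)
    calc (2 * sizeBound N ((N : ℝ) ^ ζ) + 1) * (N : ℝ) ^ (-(1 + ω) / 2) ≤
          (31 * (N : ℝ) ^ ((1 - ζ) / 2)) * (N : ℝ) ^ (-(1 + ω) / 2) := by
          gcongr; linarith
      _ = 31 * (N : ℝ) ^ (-(ζ + ω) / 2) := by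
          rw [mul_assoc, ← Real.rpow_add hN']
          congr 2
          ring
  rw [newRepsBound, ht2]
  linarith

lemma suspectsBound_div_le (hN : 0 < N) :
    suspectsBound N g ((N : ℝ) ^ ζ) / N ≤
      612 * (N : ℝ) ^ (-ζ) + 1530 * (N : ℝ) ^ (-((ζ * (2 * g + 1) - 1) / 2)) := by
  have hN' : (0 : ℝ) < N := by exact_mod_cast hN
  have hs := sizeBound_le (ζ := ζ) hN
  have h1 : sizeBound N ((N : ℝ) ^ ζ) ^ 2 = 204 * N / (N : ℝ) ^ ζ :=
    Real.sq_sqrt (by positivity)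
  have e1 : (N : ℝ) ^ (-ζ) = 1 / (N : ℝ) ^ ζ := by rw [Real.rpow_neg hN'.le, one_div]
  have e2 : (N : ℝ) ^ (-((ζ * (2 * g + 1) - 1) / 2)) =
      (N : ℝ) ^ ((1 - ζ) / 2) / ((N : ℝ) ^ ζ) ^ g := by
    rw [← Real.rpow_natCast ((N : ℝ) ^ ζ), ← Real.rpow_mul hN'.le, ← Real.rpow_sub hN']
    congr 1
    ring
  rw [suspectsBound, h1, e1, e2]
  have e3 : (3 * (204 * N / (N : ℝ) ^ ζ) + sizeBound N ((N : ℝ) ^ ζ) *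
      (102 * N / ((N : ℝ) ^ ζ) ^ g)) / N =
      612 * (1 / (N : ℝ) ^ ζ) + 102 * (sizeBound N ((N : ℝ) ^ ζ) / ((N : ℝ) ^ ζ) ^ g) := by
    field_simp
    ring
  rw [e3]
  have h2 : sizeBound N ((N : ℝ) ^ ζ) / ((N : ℝ) ^ ζ) ^ g ≤
      15 * (N : ℝ) ^ ((1 - ζ) / 2) / ((N : ℝ) ^ ζ) ^ g := by gcongr
  rw [mul_div_assoc] at h2
  linarith

open Filter in
lemma eventually_const_le_rpow {c : ℝ} (hc : 0 < c) (K : ℝ) :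
    ∀ᶠ N : ℕ in atTop, K ≤ (N : ℝ) ^ c :=
  ((tendsto_rpow_atTop hc).comp tendsto_natCast_atTop_atTop).eventually_ge_atTop K

open Filter in
/-- The hypotheses of `exists_stage` hold at all large scales. -/
lemma eventually_exists_stage (hg : 2 ≤ g) (hζ0 : 0 < ζ) (hζg : 1 < ζ * (2 * g + 1)) (hζω : ζ < ω)
    (hω : ω < ω') (hω1 : ω < 1) :
    ∀ᶠ N : ℕ in atTop, ∀ W ⊆ range (N + 1), (N : ℝ) ^ ω' ≤ W.card →
      ∀ A ⊆ range (12 * N + 1), (∀ m, (reps A m).card ≤ g) →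
      potential N ((N : ℝ) ^ ζ) A ≤ 100 * N →
      ∃ A', A ⊆ A' ∧ A' ⊆ range (12 * N + 1) ∧ (∀ m, (reps A' m).card ≤ g) ∧
        potential N ((N : ℝ) ^ ζ) A' ≤ 101 * N ∧ ∀ n ∈ Ico (6 * N) (12 * N), Covers A' W n := by
  obtain ⟨c, hc0, hc⟩ : ∃ c : ℝ, 0 < c ∧ c ≤ ω' - ω ∧ c ≤ (1 - ω) / 2 ∧ c ≤ ζ ∧
      c ≤ (ζ * (2 * g + 1) - 1) / 2 := by
    refine ⟨min (min (ω' - ω) ((1 - ω) / 2)) (min ζ ((ζ * (2 * g + 1) - 1) / 2)), ?_, ?_⟩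
    · refine lt_min (lt_min ?_ ?_) (lt_min ?_ ?_) <;> linarith
    · simp
  obtain ⟨hc1, hc2, hc3, hc4⟩ := hc
  obtain ⟨T, hT⟩ := exists_nat_ge (4 / c)
  have hT0 : (0 : ℝ) < T := lt_of_lt_of_le (by positivity) hT
  have hTc : 2 ≤ c / 2 * T := by
    rw [div_le_iff₀ hc0] at hT
    linarith
  have hL : 0 < Real.log (1 + 1 / (404 * T)) :=
    Real.log_pos (by have : 0 < 1 / (404 * (T : ℝ)) := by positivity
                     linarith)
  filter_upwards [eventually_ge_atTop 7, eventually_const_le_rpow hζ0 2,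
    eventually_const_le_rpow (by positivity : 0 < c / 2) (4 * 34656),
    eventually_const_le_rpow (by linarith : 0 < (ω - ζ) / 2)
      (44 / Real.log (1 + 1 / (404 * T)))] with N hN7 hz hη hexp W hW hWc A hA hAg hF
  have hN7' : (7 : ℝ) ≤ N := by exact_mod_cast hN7
  have hN' : (0 : ℝ) < N := by linarith
  have hN1 : (1 : ℝ) ≤ N := by linarith
  have hN : 0 < N := by omega
  have hWc0 : (0 : ℝ) < W.card := lt_of_lt_of_le (by positivity) hWc
  have hW0 : W.Nonempty := Finset.card_pos.mp (by exact_mod_cast hWc0)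
  have hρ := newRepsBound_le hN hζ0 (hζω.trans hω1) hζω
  have hS := suspectsBound_div_le (g := g) (ζ := ζ) hN
  set t := (N : ℝ) ^ (-(1 + ω) / 2) with ht
  have ht0 : 0 < t := by positivity
  have ht1 : t ≤ 1 := Real.rpow_le_one_of_one_le_of_nonpos hN1 (by linarith)
  have hs0 : 0 ≤ sizeBound N ((N : ℝ) ^ ζ) := Real.sqrt_nonneg _
  have hρ0 : 0 ≤ newRepsBound N t ((N : ℝ) ^ ζ) := by unfold newRepsBound; positivity
  have hS0 : 0 ≤ suspectsBound N g ((N : ℝ) ^ ζ) := by unfold suspectsBound; positivity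
  have hle : ∀ e : ℝ, c ≤ e → (N : ℝ) ^ (-e) ≤ (N : ℝ) ^ (-c) := fun e he =>
    Real.rpow_le_rpow_of_exponent_le hN1 (by linarith)
  refine exists_stage (T := T) (η := (N : ℝ) ^ (-(c / 2))) hN hg (by exact_mod_cast hT0) ht0 ht1 hz
    hW hW0 rfl (by positivity) ?_ ?_ ?_ hA hAg hF
  · have h1 : (N : ℝ) ^ ζ * newRepsBound N t ((N : ℝ) ^ ζ) ≤ Real.log (1 + 1 / (404 * T)) := by
      calc _ ≤ (N : ℝ) ^ ζ * (44 * (N : ℝ) ^ (-(ζ + ω) / 2)) := by gcongr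
        _ = 44 / (N : ℝ) ^ ((ω - ζ) / 2) := by
          rw [mul_left_comm, ← Real.rpow_add hN', div_eq_mul_inv 44, ← Real.rpow_neg hN'.le]
          congr 2
          ring
        _ ≤ _ := by
          rw [div_le_iff₀ hL] at hexp
          rw [div_le_iff₀ (by positivity)]
          linarith
    have h2 := Real.exp_le_exp.mpr h1
    rw [Real.exp_log (by positivity)] at h2
    calc _ ≤ 101 * N * (1 / (404 * T) : ℝ) := by
          gcongr
          linarith
      _ = N / T / 4 := by
          field_simp
          norm_num
  · refine (tail_bound_le hN' hWc0 ht0 ht1 (by positivity)).trans ?_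
    have h1 : 1 / (N * W.card * t ^ 2) ≤ (N : ℝ) ^ (-c) := by
      calc 1 / (N * W.card * t ^ 2) ≤ 1 / (N * (N : ℝ) ^ ω' * t ^ 2) := by gcongr
        _ = (N : ℝ) ^ (-(ω' - ω)) := by
          have : (N : ℝ) * (N : ℝ) ^ ω' * t ^ 2 = (N : ℝ) ^ (ω' - ω) := by
            nth_rw 1 [← Real.rpow_one (N : ℝ)]
            rw [ht, ← Real.rpow_natCast, ← Real.rpow_mul hN'.le, ← Real.rpow_add hN',
              ← Real.rpow_add hN']
            congr 1
            push_cast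
            ring
          rw [this, Real.rpow_neg hN'.le, one_div]
        _ ≤ _ := hle _ hc1
    have h2 : 1 / (N * t) ≤ (N : ℝ) ^ (-c) := by
      have : (N : ℝ) * t = (N : ℝ) ^ ((1 - ω) / 2) := by
        nth_rw 1 [← Real.rpow_one (N : ℝ)]
        rw [ht, ← Real.rpow_add hN']
        congr 1
        ring
      rw [this, one_div, ← Real.rpow_neg hN'.le]
      exact hle _ hc2
    have h3 : (N : ℝ) ^ (-(ζ + ω) / 2) ≤ (N : ℝ) ^ (-c) := by
      rw [neg_div]
      exact hle _ (by linarith)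
    have h4 := hle _ hc3
    have h5 := hle _ hc4
    have h6 : 4 * 34656 * (N : ℝ) ^ (-c) ≤ (N : ℝ) ^ (-(c / 2)) := by
      have : (N : ℝ) ^ (-(c / 2)) = (N : ℝ) ^ (c / 2) * (N : ℝ) ^ (-c) := by
        rw [← Real.rpow_add hN']
        congr 1
        ring
      rw [this]
      gcongr
    rw [← mul_one_div 16 (_ * _ * _), ← mul_one_div 16 (_ * _)]
    linarith
  · rw [← Real.rpow_natCast, ← Real.rpow_mul hN'.le]
    calc (N : ℝ) ^ (-(c / 2) * T) * (6 * N) ≤ (N : ℝ) ^ (-2 : ℝ) * (6 * N) := by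
          gcongr
          linarith
      _ = 6 / N := by
          rw [Real.rpow_neg hN'.le, Real.rpow_two]
          field_simp
      _ < 1 := by
          rw [div_lt_one hN']
          linarith

end Asymptotics

/-- The condition on the set constructed so far that the next stage, at scale `N`, requires. -/
structure IsAdmissible (g : ℕ) (ζ : ℝ) (N : ℕ) (A : Finset ℕ) : Prop where
  subset : A ⊆ range (12 * N + 1)
  card_reps_le (m : ℕ) : (reps A m).card ≤ g
  potential_le : potential N ((N : ℝ) ^ ζ) A ≤ 100 * N

section Sequence

variable {g N : ℕ} {ζ ω' ε : ℝ} {A : Finset ℕ}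

lemma isAdmissible_empty (hN : 0 < N) : IsAdmissible g ζ N ∅ where
  subset := by simp
  card_reps_le m := by simp [reps]
  potential_le := by
    have : (1 : ℝ) ≤ N := by exact_mod_cast hN
    simp only [potential, reps, Finset.notMem_empty, and_false, Finset.filter_false,
      Finset.card_empty, pow_zero, Finset.sum_const, Finset.card_range, nsmul_one]
    push_cast
    linarith

lemma IsAdmissible.two_mul (hN : 0 < N) (hζ0 : 0 < ζ) (hζg : ζ * g ≤ 1 / 2)
    (hA : A ⊆ range (12 * N + 1)) (hAg : ∀ m, (reps A m).card ≤ g)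
    (hF : potential N ((N : ℝ) ^ ζ) A ≤ 101 * N) : IsAdmissible g ζ (2 * N) A where
  subset := hA.trans (Finset.range_mono (by omega))
  card_reps_le := hAg
  potential_le := by
    have hN1 : (1 : ℝ) ≤ N := by exact_mod_cast hN
    have hsqrt : √2 ≤ (3 / 2 : ℝ) := Real.sqrt_le_iff.mpr ⟨by norm_num, by norm_num⟩
    have h2 : (1 : ℝ) ≤ 2 ^ ζ := Real.one_le_rpow one_le_two hζ0.le
    have h2g : ((2 : ℝ) ^ ζ) ^ g ≤ 3 / 2 := by
      rw [← Real.rpow_natCast, ← Real.rpow_mul zero_le_two]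
      refine (Real.rpow_le_rpow_of_exponent_le one_le_two hζg).trans ?_
      rwa [← Real.sqrt_eq_rpow]
    have hpot : ∑ m ∈ range (24 * N + 1), (((2 * N : ℕ) : ℝ) ^ ζ) ^ (reps A m).card ≤
        3 / 2 * (101 * N) := by
      refine le_trans ?_ (mul_le_mul_of_nonneg_left hF (by norm_num))
      rw [potential, Finset.mul_sum]
      refine Finset.sum_le_sum fun m _ => ?_
      push_cast
      rw [Real.mul_rpow zero_le_two (by positivity), mul_pow]
      gcongr
      exact (pow_le_pow_right₀ h2 (hAg m)).trans h2g
    have hrest : ∀ m ∈ Ico (24 * N + 1) (24 * (2 * N) + 1),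
        (((2 * N : ℕ) : ℝ) ^ ζ) ^ (reps A m).card = 1 := by
      intro m hm
      rw [Finset.mem_Ico] at hm
      have : reps A m = ∅ := by
        rw [Finset.eq_empty_iff_forall_notMem]
        intro x hx
        simp only [reps, Finset.mem_filter] at hx
        have h1 := Finset.mem_range.mp (hA hx.2.2.1)
        have h2 := Finset.mem_range.mp (hA hx.2.2.2)
        omega
      rw [this, Finset.card_empty, pow_zero]
    rw [potential, ← Finset.sum_range_add_sum_Ico _ (by omega : 24 * N + 1 ≤ 24 * (2 * N) + 1),
      Finset.sum_congr rfl hrest, Finset.sum_const, Nat.card_Ico, nsmul_one]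
    have : 24 * (2 * N) + 1 - (24 * N + 1) = 24 * N := by omega
    rw [this]
    push_cast at hpot ⊢
    linarith

/-- The set of third summands used at scale `N`: it consists of small elements of `A` as soon as
there are enough of them. -/
lemma exists_small_summands (hω : ω' ≤ 1) (hε : ε ≤ 1) (hN : 0 < N) (A : Finset ℕ) :
    ∃ W ⊆ range (N + 1), (N : ℝ) ^ ω' ≤ W.card ∧ (W.card : ℝ) ≤ (N : ℝ) ^ ω' + 1 ∧
      ∀ B ⊆ A, (∀ b ∈ B, (b : ℝ) ≤ (N : ℝ) ^ ε) → (N : ℝ) ^ ω' + 1 ≤ B.card →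
        W ⊆ A ∧ ∀ w ∈ W, (w : ℝ) ≤ (N : ℝ) ^ ε := by
  classical
  have hN1 : (1 : ℝ) ≤ N := by exact_mod_cast hN
  have hle : ∀ e : ℝ, e ≤ 1 → (N : ℝ) ^ e ≤ N := fun e he =>
    (Real.rpow_le_rpow_of_exponent_le hN1 he).trans_eq (Real.rpow_one _)
  have hceil : (⌈(N : ℝ) ^ ω'⌉₊ : ℝ) ≤ (N : ℝ) ^ ω' + 1 :=
    (Nat.ceil_lt_add_one (by positivity)).le
  by_cases h : ∃ B ⊆ A, (∀ b ∈ B, (b : ℝ) ≤ (N : ℝ) ^ ε) ∧ (N : ℝ) ^ ω' + 1 ≤ B.card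
  · obtain ⟨B, hBA, hB, hBc⟩ := h
    obtain ⟨W, hWB, hWc⟩ := Finset.exists_subset_card_eq
      (by exact_mod_cast hceil.trans hBc : ⌈(N : ℝ) ^ ω'⌉₊ ≤ B.card)
    refine ⟨W, fun w hw => ?_, hWc ▸ Nat.le_ceil _, hWc ▸ hceil,
      fun _ _ _ _ => ⟨hWB.trans hBA, fun w hw => hB w (hWB hw)⟩⟩
    have : w ≤ N := by exact_mod_cast (hB w (hWB hw)).trans (hle ε hε)
    exact Finset.mem_range.mpr (by omega)
  · refine ⟨range ⌈(N : ℝ) ^ ω'⌉₊, Finset.range_mono ?_, ?_, ?_,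
      fun B hBA hB hBc => absurd ⟨B, hBA, hB, hBc⟩ h⟩
    · exact (Nat.ceil_le.mpr (hle ω' hω)).trans (Nat.le_succ N)
    · rw [Finset.card_range]; exact Nat.le_ceil _
    · rwa [Finset.card_range]

/-- The construction of the sequence, without the claim that the third summands lie in it. -/
lemma exists_chain {ω : ℝ} (hg : 2 ≤ g) (hζ0 : 0 < ζ) (hζg : 1 < ζ * (2 * g + 1))
    (hζg' : ζ * g ≤ 1 / 2) (hζω : ζ < ω) (hω : ω < ω') (hω1 : ω' < 1) (hε : ε ≤ 1) :
    ∃ (N₁ : ℕ) (A : ℕ → Finset ℕ), 0 < N₁ ∧ Monotone A ∧ (∀ k m, (reps (A k) m).card ≤ g) ∧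
      (∀ k, A (k + 1) ⊆ range (12 * (2 ^ k * N₁) + 1)) ∧
      ∀ k, ∃ W : Finset ℕ, (W.card : ℝ) ≤ ((2 ^ k * N₁ : ℕ) : ℝ) ^ ω' + 1 ∧
        (∀ n ∈ Ico (6 * (2 ^ k * N₁)) (12 * (2 ^ k * N₁)), Covers (A (k + 1)) W n) ∧
        ∀ B ⊆ A k, (∀ b ∈ B, (b : ℝ) ≤ ((2 ^ k * N₁ : ℕ) : ℝ) ^ ε) →
          ((2 ^ k * N₁ : ℕ) : ℝ) ^ ω' + 1 ≤ B.card →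
          W ⊆ A k ∧ ∀ w ∈ W, (w : ℝ) ≤ ((2 ^ k * N₁ : ℕ) : ℝ) ^ ε := by
  obtain ⟨N₀, hN₀⟩ := Filter.eventually_atTop.mp
    (eventually_exists_stage hg hζ0 hζg hζω hω (hω.trans hω1))
  set N₁ := N₀ + 1
  have hpos : ∀ k, 0 < 2 ^ k * N₁ := fun k => by positivity
  have hge : ∀ k, N₀ ≤ 2 ^ k * N₁ := fun k =>
    (Nat.le_succ N₀).trans (Nat.le_mul_of_pos_left N₁ (by positivity))
  choose W hWN hWc hWc' hW using fun k => exists_small_summands (N := 2 ^ k * N₁) hω1.le hε (hpos k)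
  have hstep : ∀ k (A : {A // IsAdmissible g ζ (2 ^ k * N₁) A}),
      ∃ A' : {A // IsAdmissible g ζ (2 ^ (k + 1) * N₁) A}, A.1 ⊆ A'.1 ∧
        A'.1 ⊆ range (12 * (2 ^ k * N₁) + 1) ∧
        ∀ n ∈ Ico (6 * (2 ^ k * N₁)) (12 * (2 ^ k * N₁)), Covers A'.1 (W k A.1) n := by
    rintro k ⟨A, hA⟩
    obtain ⟨A', hAA', hA', hA'g, hpot, hcov⟩ := hN₀ _ (hge k) (W k A) (hWN k A) (hWc k A) A
      hA.subset hA.card_reps_le hA.potential_le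
    refine ⟨⟨A', ?_⟩, hAA', hA', hcov⟩
    rw [pow_succ', mul_assoc]
    exact IsAdmissible.two_mul (hpos k) hζ0 hζg' hA' hA'g hpot
  choose next hnext using hstep
  let A : ∀ k, {A // IsAdmissible g ζ (2 ^ k * N₁) A} := fun k =>
    Nat.rec ⟨∅, isAdmissible_empty (hpos 0)⟩ next k
  exact ⟨N₁, fun k => (A k).1, Nat.succ_pos _,
    monotone_nat_of_le_succ fun k => (hnext k (A k)).1, fun k => (A k).2.card_reps_le,
    fun k => (hnext k (A k)).2.1, fun k => ⟨W k (A k).1, hWc' k _, (hnext k (A k)).2.2, hW k _⟩⟩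

lemma le_card_sq_mul_card {W : Finset ℕ}
    (h : ∀ n ∈ Ico (6 * N) (12 * N), Covers A W n) : 6 * N ≤ A.card ^ 2 * W.card := by
  have hsub : Ico (6 * N) (12 * N) ⊆ (A ×ˢ A ×ˢ W).image fun p => p.1 + p.2.1 + p.2.2 := by
    intro n hn
    obtain ⟨a, ha, b, hb, w, hw, e⟩ := h n hn
    exact Finset.mem_image.mpr ⟨(a, b, w), by simp [ha, hb, hw], e.symm⟩
  have := (Finset.card_le_card hsub).trans Finset.card_image_le
  rw [Nat.card_Ico, Finset.card_product, Finset.card_product] at this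
  calc 6 * N = 12 * N - 6 * N := by omega
    _ ≤ A.card * (A.card * W.card) := this
    _ = _ := by ring

lemma exists_two_pow_mul_le {N₁ : ℕ} (hN₁ : 0 < N₁) {y : ℝ} (hy : N₁ ≤ y) :
    ∃ k : ℕ, ((2 ^ k * N₁ : ℕ) : ℝ) ≤ y ∧ y < 2 * ((2 ^ k * N₁ : ℕ) : ℝ) := by
  have h0 : (0 : ℝ) < N₁ := by exact_mod_cast hN₁
  obtain ⟨k, hk, hk'⟩ := exists_nat_pow_near (x := y / N₁) ((one_le_div h0).mpr hy) one_lt_two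
  rw [le_div_iff₀ h0] at hk
  rw [div_lt_iff₀ h0, pow_succ'] at hk'
  exact ⟨k, by exact_mod_cast hk, by push_cast; linarith⟩

lemma isB2g_iUnion {A : ℕ → Finset ℕ} (hA : Monotone A) (hg : ∀ k m, (reps (A k) m).card ≤ g) :
    IsB2g (⋃ k, (A k : Set ℕ)) g := by
  intro m
  obtain ⟨k, hk⟩ : ∃ k, ∀ a ≤ m, (a ∈ ⋃ k, (A k : Set ℕ)) → a ∈ A k := by
    choose! f hf using fun a (ha : a ∈ ⋃ k, (A k : Set ℕ)) => Set.mem_iUnion.mp ha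
    exact ⟨(range (m + 1)).sup f, fun a ham ha =>
      hA (Finset.le_sup (Finset.mem_range.mpr (by omega))) (hf a ha)⟩
  refine le_trans ?_ (hg k m)
  rw [rA, ← Set.ncard_coe_finset]
  refine Set.ncard_le_ncard_of_injOn Prod.fst ?_ ?_ (Finset.finite_toSet _)
  · rintro ⟨a, b⟩ ⟨ha, hb, hab, rfl⟩
    simp only [reps, Finset.coe_filter, Set.mem_ofPred_eq, Finset.mem_range]
    simp only at ha hb hab
    rw [Nat.add_sub_cancel_left]
    exact ⟨by omega, by omega, hk a (by omega) ha, hk b (by omega) hb⟩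
  · rintro ⟨a, b⟩ ⟨-, -, -, h⟩ ⟨c, d⟩ ⟨-, -, -, h'⟩ e
    simp only at h h' e
    simp only [Prod.mk.injEq]
    omega

open Filter in
lemma eventually_small_enough {N₁ : ℕ} (hω0 : 0 < ω') (hω1 : ω' < 1) (hε0 : 0 < ε)
    (hωε : 2 * ω' < ε * (1 - ω')) :
    ∀ᶠ N : ℕ in atTop, 0 < N ∧ 12 * (N₁ : ℝ) ≤ (N : ℝ) ^ ε ∧ ∀ y a : ℝ, 1 ≤ y →
      (N : ℝ) ^ ε < 24 * y → 0 ≤ a → 6 * y ≤ a ^ 2 * (y ^ ω' + 1) → (N : ℝ) ^ ω' + 1 ≤ a := by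
  filter_upwards [eventually_gt_atTop 0, eventually_const_le_rpow hε0 (12 * N₁),
    eventually_const_le_rpow (by linarith : 0 < ε * (1 - ω') - 2 * ω') 32] with N hN h12 h32
  refine ⟨hN, h12, fun y a hy hNy ha hya => ?_⟩
  have hN1 : (1 : ℝ) ≤ N := by exact_mod_cast hN
  have hN' : (0 : ℝ) < N := by linarith
  have hy0 : 0 < y := by linarith
  have h1 : 1 ≤ y ^ ω' := Real.one_le_rpow hy hω0.le
  have h2 : 1 ≤ (N : ℝ) ^ ω' := Real.one_le_rpow hN1 hω0.le
  have hyy : y = y ^ (1 - ω') * y ^ ω' := by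
    rw [← Real.rpow_add hy0]
    simp
  have h3 : 3 * y ^ (1 - ω') ≤ a ^ 2 := by
    have : 6 * y ≤ 2 * a ^ 2 * y ^ ω' := by nlinarith [sq_nonneg a]
    refine le_of_mul_le_mul_right ?_ (by positivity : 0 < y ^ ω')
    linarith
  have h4 : (N : ℝ) ^ (ε * (1 - ω')) ≤ 24 * y ^ (1 - ω') := by
    rw [Real.rpow_mul hN'.le]
    calc ((N : ℝ) ^ ε) ^ (1 - ω') ≤ (24 * y) ^ (1 - ω') := by
          gcongr
      _ = 24 ^ (1 - ω') * y ^ (1 - ω') := Real.mul_rpow (by norm_num) hy0.le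
      _ ≤ 24 * y ^ (1 - ω') := by
          gcongr
          exact (Real.rpow_le_rpow_of_exponent_le (by norm_num) (by linarith)).trans_eq
            (Real.rpow_one _)
  have h5 : 32 * ((N : ℝ) ^ ω') ^ 2 ≤ (N : ℝ) ^ (ε * (1 - ω')) := by
    have : (N : ℝ) ^ (ε * (1 - ω')) = (N : ℝ) ^ (ε * (1 - ω') - 2 * ω') * ((N : ℝ) ^ ω') ^ 2 := by
      rw [← Real.rpow_natCast ((N : ℝ) ^ ω'), ← Real.rpow_mul hN'.le, ← Real.rpow_add hN']
      congr 1
      push_cast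
      ring
    rw [this]
    gcongr
  refine le_of_sq_le_sq ?_ ha
  nlinarith

end Sequence

end

theorem stmt1 (ε : ℝ) (hε0 : 0 < ε) (hε1 : ε < 1) (g : ℕ) (hg : 1 / ε < (g : ℝ)) :
    ∃ (A : Set ℕ) (N₀ : ℕ), IsB2g A g ∧
      ∀ n : ℕ, N₀ ≤ n → ∃ a₁ ∈ A, ∃ a₂ ∈ A, ∃ a₃ ∈ A,
        n = a₁ + a₂ + a₃ ∧ (a₃ : ℝ) ≤ (n : ℝ) ^ ε := by
  have hg1 : (1 : ℝ) < g := ((one_lt_one_div hε0 hε1)).trans hg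
  have hg2 : 2 ≤ g := by exact_mod_cast hg1
  have hεg : 1 < ε * g := by
    rw [div_lt_iff₀ hε0] at hg
    linarith
  obtain ⟨ω', hω'1, hω'2⟩ : ∃ ω' : ℝ, 1 / (2 * (g : ℝ) + 1) < ω' ∧
      ω' < min (1 / (2 * (g : ℝ))) (ε / (2 + ε)) := by
    refine exists_between (lt_min ?_ ?_)
    · exact one_div_lt_one_div_of_lt (by linarith) (by linarith)
    · rw [div_lt_div_iff₀ (by linarith) (by linarith)]
      linarith
  obtain ⟨ω, hω1, hω2⟩ := exists_between hω'1
  obtain ⟨ζ, hζ1, hζ2⟩ := exists_between hω1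
  obtain ⟨hω'g, hω'ε⟩ := lt_min_iff.mp hω'2
  rw [lt_div_iff₀ (by linarith)] at hω'g hω'ε
  have hζ0 : 0 < ζ := lt_trans (by positivity) hζ1
  rw [div_lt_iff₀ (by linarith)] at hζ1
  have hω'0 : 0 < ω' := by linarith
  have hω'l : ω' < 1 := by nlinarith
  obtain ⟨N₁, A, hN₁, hmono, hreps, hrange, hW⟩ := exists_chain (ε := ε) hg2 hζ0 hζ1
    (by nlinarith) hζ2 hω2 hω'l hε1.le
  obtain ⟨N₂, hN₂⟩ := Filter.eventually_atTop.mp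
    (eventually_small_enough (N₁ := N₁) hω'0 hω'l hε0 (by linarith))
  refine ⟨⋃ k, (A k : Set ℕ), 12 * N₁ + 12 * N₂, isB2g_iUnion hmono hreps, fun n hn => ?_⟩
  have hn' : (12 * N₁ + 12 * N₂ : ℝ) ≤ n := by exact_mod_cast hn
  obtain ⟨k, hk1, hk2⟩ := exists_two_pow_mul_le hN₁ (y := n / 6) (by linarith)
  obtain ⟨W, -, hcov, hWA⟩ := hW k
  set N := 2 ^ k * N₁ with hN
  have hk1' : 6 * N ≤ n := by exact_mod_cast (by linarith : (6 * N : ℝ) ≤ n)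
  have hk2' : n < 12 * N := by exact_mod_cast (by linarith : (n : ℝ) < 12 * N)
  obtain ⟨hN0, hN12, hcard⟩ := hN₂ N (by omega)
  have hN1 : (1 : ℝ) ≤ N := by exact_mod_cast hN0
  obtain ⟨i, hi1, hi2⟩ := exists_two_pow_mul_le hN₁ (y := (N : ℝ) ^ ε / 12) (by linarith)
  obtain ⟨W', hW'c, hW'cov, -⟩ := hW i
  set M := 2 ^ i * N₁ with hM
  have hM0 : 0 < M := by positivity
  have hMN : M < N := by
    have h1 : (N : ℝ) ^ ε ≤ N :=
      (Real.rpow_le_rpow_of_exponent_le hN1 hε1.le).trans_eq (Real.rpow_one _)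
    have h2 : (M : ℝ) < N := by linarith
    exact_mod_cast h2
  have hik : i + 1 ≤ k := (Nat.pow_lt_pow_iff_right (by norm_num)).mp
    (Nat.lt_of_mul_lt_mul_right hMN)
  obtain ⟨hWk, hWle⟩ := hWA (A (i + 1)) (hmono hik)
    (fun b hb => by
      have h1 := Finset.mem_range.mp (hrange i hb)
      have h2 : (b : ℝ) ≤ 12 * M := by exact_mod_cast (by omega : b ≤ 12 * M)
      linarith)
    (hcard M _ (by exact_mod_cast hM0) (by linarith) (by positivity) (by
      have h1 : (6 * M : ℝ) ≤ (A (i + 1)).card ^ 2 * W'.card := by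
        exact_mod_cast le_card_sq_mul_card hW'cov
      refine h1.trans ?_
      gcongr))
  obtain ⟨a, ha, b, hb, w, hw, e⟩ := hcov n (Finset.mem_Ico.mpr ⟨hk1', hk2'⟩)
  refine ⟨a, Set.mem_iUnion.mpr ⟨_, ha⟩, b, Set.mem_iUnion.mpr ⟨_, hb⟩, w,
    Set.mem_iUnion.mpr ⟨_, hWk hw⟩, e, (hWle w hw).trans ?_⟩
  gcongr
  omega
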